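/- arXiv:1902.06503 — 2 statements merged into one kernel-verified Lean document; each statement's English description precedes it below -/
import Mathlib

section
/- Let n ≥ 5 and γ ∈ (0, π), and let L_γ be the fourth-order operator on ℝⁿ with symbol Q_γ(ξ′, ξ_n) = |ξ′|⁴ + 2cos(γ)|ξ′|²ξ_n² + ξ_n⁴, i.e. L_γ = (Δ′)² + 2cos(γ)Δ′(∂/∂x_n)² + (∂/∂x_n)⁴. If F : ℝⁿ → ℝ is locally integrable, continuous on ℝⁿ\{0}, homogeneous of degree 4−n, and a fundamental solution of L_γ, then for every x_n ≠ 0: F(0,…,0,x_n) = Γ(n−4) · sin(((n−3)/2)γ) / (2^{n−1} Γ((n−1)/2) π^{(n−1)/2} |x_n|^{n−4} sin(γ)). -/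
open MeasureTheory RealInnerProductSpace

noncomputable section

/-- ℝⁿ as a Euclidean space. -/
abbrev En (n : ℕ) : Type := EuclideanSpace ℝ (Fin n)

/-- The `i`-th standard basis vector of ℝⁿ. -/
def stdB (n : ℕ) (i : Fin n) : En n := EuclideanSpace.single i 1

/-- The symbol Q(ξ) = Σ_{i₁,…,i_{2m}} A_{i₁…i_{2m}} ξ_{i₁}⋯ξ_{i_{2m}}. -/
def symbolQ (n m : ℕ) (A : (Fin (2*m) → Fin n) → ℝ) (ξ : En n) : ℝ :=
  ∑ i : Fin (2*m) → Fin n, A i * ∏ j, ξ (i j)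

/-- The constant-coefficient operator
(Lψ)(x) = (−1)^m Σ A_{i₁…i_{2m}} ∂_{i₁}⋯∂_{i_{2m}} ψ(x). -/
def opL (n m : ℕ) (A : (Fin (2*m) → Fin n) → ℝ) (ψ : En n → ℝ) (x : En n) : ℝ :=
  (-1 : ℝ)^m * ∑ i : Fin (2*m) → Fin n,
    A i * iteratedFDeriv ℝ (2*m) ψ x (fun j => stdB n (i j))

/-- K is a fundamental solution of L: ∫ K(y) (Lψ)(y) dy = ψ(0) for all ψ ∈ C_c^∞. -/
def IsFundamentalSolution (n m : ℕ) (A : (Fin (2*m) → Fin n) → ℝ) (K : En n → ℝ) : Prop :=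
  ∀ ψ : En n → ℝ, ContDiff ℝ (⊤ : ℕ∞) ψ → HasCompactSupport ψ →
    ∫ y, K y * opL n m A ψ y = ψ 0

/-- K is homogeneous of degree a: K(σx) = |σ|^a K(x) for σ ≠ 0, x ≠ 0. -/
def HomogeneousDeg (n : ℕ) (a : ℝ) (K : En n → ℝ) : Prop :=
  ∀ σ : ℝ, σ ≠ 0 → ∀ x : En n, x ≠ 0 → K (σ • x) = |σ| ^ a * K x

/-- The Euclidean Laplacian Δf(x) = Σ_i ∂²f/∂x_i²(x). -/
def lap (n : ℕ) (f : En n → ℝ) (x : En n) : ℝ :=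
  ∑ i : Fin n, iteratedFDeriv ℝ 2 f x (fun _ => stdB n i)

/-- The point (x′, t) ∈ ℝ^{d} × ℝ = ℝ^{d+1}. -/
def snocVec (d : ℕ) (x' : En d) (t : ℝ) : En (d+1) :=
  (EuclideanSpace.equiv (Fin (d+1)) ℝ).symm (Fin.snoc (fun i => x' i) t)

/-- The fourth-order operator L_γ = (Δ′)² + 2cos(γ)Δ′(∂/∂x_n)² + (∂/∂x_n)⁴
on ℝ^{d+1}, acting on smooth functions. -/
def Lgamma (d : ℕ) (γ : ℝ) (ψ : En (d+1) → ℝ) (x : En (d+1)) : ℝ :=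
  (∑ i : Fin d, ∑ j : Fin d,
      iteratedFDeriv ℝ 4 ψ x
        ![stdB (d+1) i.castSucc, stdB (d+1) i.castSucc,
          stdB (d+1) j.castSucc, stdB (d+1) j.castSucc])
  + 2 * Real.cos γ *
    (∑ i : Fin d,
      iteratedFDeriv ℝ 4 ψ x
        ![stdB (d+1) i.castSucc, stdB (d+1) i.castSucc,
          stdB (d+1) (Fin.last d), stdB (d+1) (Fin.last d)])
  + iteratedFDeriv ℝ 4 ψ x
      ![stdB (d+1) (Fin.last d), stdB (d+1) (Fin.last d),
        stdB (d+1) (Fin.last d), stdB (d+1) (Fin.last d)]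



lemma nat_le_top' (k : ℕ) : ((k : ℕ) : WithTop ℕ∞) ≤ ((⊤ : ℕ∞) : WithTop ℕ∞) := by
  exact_mod_cast (le_top : (k : ℕ∞) ≤ ⊤)

lemma exp_bound (m : ℕ) (δ : ℝ) (hδ : 0 < δ) :
    ∃ C : ℝ, 0 < C ∧ ∀ r : ℝ, 0 ≤ r → (1 + r) ^ m ≤ C * Real.exp (δ * r ^ 2) := by
  rcases Nat.eq_zero_or_pos m with rfl | hm
  · exact ⟨1, one_pos, fun r _ => by simp; positivity⟩
  have hm' : (0 : ℝ) < m := by exact_mod_cast hm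
  set η := δ / m with hη
  have hηp : 0 < η := by positivity
  refine ⟨(2 + 1 / η) ^ m, by positivity, fun r hr => ?_⟩
  have h1 : 1 + r ≤ (2 + 1 / η) * Real.exp (η * r ^ 2) := by
    have h2 := Real.add_one_le_exp (η * r ^ 2)
    have h3 : (2 + 1 / η) * (η * r ^ 2 + 1) ≤ (2 + 1 / η) * Real.exp (η * r ^ 2) := by gcongr
    have h4 : (2 + 1 / η) * (η * r ^ 2 + 1) = 2 * η * r ^ 2 + r ^ 2 + 2 + 1 / η := by
      field_simp; ring
    have h5 : 0 < 1 / η := by positivity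
    have h6 : 0 ≤ η * r ^ 2 := by positivity
    nlinarith [sq_nonneg (r - 1)]
  calc (1 + r) ^ m ≤ ((2 + 1 / η) * Real.exp (η * r ^ 2)) ^ m := by gcongr
    _ = _ := by
      rw [mul_pow, ← Real.exp_nat_mul]
      congr 2
      rw [hη]; field_simp

lemma F_weight_int (d : ℕ) (hd : 5 ≤ d + 1) 
    (F : En (d+1) → ℝ)
    (hFloc : LocallyIntegrable F volume)
    (hFcont : ContinuousOn F {(0 : En (d+1))}ᶜ)
    (hFhom : HomogeneousDeg (d+1) ((4 : ℝ) - (d+1)) F) :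
    Integrable (fun y => F y * ((1 + ‖y‖) ^ (d+1))⁻¹) volume := by
  have hwc : Continuous (fun y : En (d+1) => ((1 + ‖y‖) ^ (d+1))⁻¹) := by
    apply Continuous.inv₀ (by fun_prop)
    intro y; positivity
  -- bound on the sphere
  obtain ⟨M, hM⟩ : ∃ M : ℝ, ∀ y ∈ Metric.sphere (0 : En (d+1)) 1, ‖F y‖ ≤ M := by
    apply (isCompact_sphere (0 : En (d+1)) 1).exists_bound_of_continuousOn
    apply hFcont.mono
    intro y hy h0
    simp only [Set.mem_singleton_iff] at h0
    subst h0; simp at hy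
  have hM0 : 0 ≤ M := by
    have := hM (stdB (d+1) 0) (by simp [stdB])
    exact (norm_nonneg _).trans this
  have hb : ∀ y : En (d+1), 1 ≤ ‖y‖ → ‖F y‖ ≤ M * ‖y‖⁻¹ := by
    intro y hy
    have hy0 : ‖y‖ ≠ 0 := by positivity
    have hyn : y ≠ 0 := by simpa using hy0
    have hsp : ‖y‖⁻¹ • y ∈ Metric.sphere (0 : En (d+1)) 1 := by
      simp [norm_smul, hy0]
    have hne : ‖y‖⁻¹ • y ≠ 0 := by simp [hyn]
    have := hFhom ‖y‖ hy0 _ hne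
    rw [smul_smul, mul_inv_cancel₀ hy0, one_smul] at this
    rw [this, norm_mul, mul_comm M]
    apply mul_le_mul _ (hM _ hsp) (norm_nonneg _) (by positivity)
    rw [abs_norm, Real.norm_of_nonneg (by positivity), ← Real.rpow_neg_one]
    apply Real.rpow_le_rpow_of_exponent_le hy
    have : (5 : ℝ) ≤ d + 1 := by exact_mod_cast hd
    linarith
  rw [← integrableOn_univ, ← Set.union_compl_self (Metric.closedBall (0 : En (d+1)) 1)]
  apply IntegrableOn.union
  · have h1 : IntegrableOn F (Metric.closedBall (0 : En (d+1)) 1) :=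
      hFloc.integrableOn_isCompact (isCompact_closedBall _ _)
    apply Integrable.mono h1 (h1.aestronglyMeasurable.mul hwc.aestronglyMeasurable)
    refine Filter.Eventually.of_forall fun y => ?_
    rw [Pi.mul_apply, norm_mul]
    apply mul_le_of_le_one_right (norm_nonneg _)
    rw [Real.norm_of_nonneg (by positivity)]
    apply inv_le_one_of_one_le₀
    apply one_le_pow₀; linarith [norm_nonneg y]
  · have h2 : Integrable (fun y : En (d+1) => (2 * M) * (1 + ‖y‖) ^ (-((d : ℝ)+2))) volume := by
      apply Integrable.const_mul
      apply integrable_one_add_norm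
      simp
    apply Integrable.mono' h2.integrableOn
      (hFloc.aestronglyMeasurable.mul hwc.aestronglyMeasurable).restrict
    refine (ae_restrict_iff' Metric.isClosed_closedBall.measurableSet.compl).2 
      (Filter.Eventually.of_forall fun y hy => ?_)
    have hy1 : 1 ≤ ‖y‖ := by
      simp at hy; exact hy.le
    rw [Pi.mul_apply, norm_mul, Real.norm_of_nonneg (r := ((1 + ‖y‖) ^ (d+1))⁻¹) (by positivity),
      Real.rpow_neg (by positivity), show (d : ℝ) + 2 = ((d + 2 : ℕ) : ℝ) by push_cast; ring,
      Real.rpow_natCast, pow_succ _ (d+1), mul_inv]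
    calc ‖F y‖ * ((1 + ‖y‖) ^ (d+1))⁻¹ ≤ (2 * M * (1 + ‖y‖)⁻¹) * ((1 + ‖y‖) ^ (d+1))⁻¹ := by
          gcongr
          apply (hb y hy1).trans
          rw [mul_comm 2 M, mul_assoc]
          gcongr
          rw [inv_le_iff_one_le_mul₀ (by positivity)]
          field_simp
          linarith
      _ = _ := by ring

lemma F_mul_int {d : ℕ} {F : En (d+1) → ℝ}
    (hFm : AEStronglyMeasurable F volume)
    (hFi : Integrable (fun y => F y * ((1 + ‖y‖) ^ (d+1))⁻¹) volume)
    {G : Type*} [NormedAddCommGroup G] [NormedSpace ℝ G]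
    (g : En (d+1) → G) (hg : AEStronglyMeasurable g volume) (C : ℝ)
    (hb : ∀ y, ‖g y‖ ≤ C * ((1 + ‖y‖) ^ (d+1))⁻¹) :
    Integrable (fun y => F y • g y) volume := by
  apply Integrable.mono' (hFi.norm.const_mul C) (hFm.smul hg)
  refine Filter.Eventually.of_forall fun y => ?_
  rw [Pi.smul_apply', norm_smul, norm_mul, Real.norm_of_nonneg (r := ((1 + ‖y‖) ^ (d+1))⁻¹) (by positivity)]
  calc ‖F y‖ * ‖g y‖ ≤ ‖F y‖ * (C * ((1 + ‖y‖) ^ (d+1))⁻¹) := by gcongr; exact hb y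
    _ = _ := by ring

/-- complex version of the operator -/
def LC (d : ℕ) (γ : ℝ) (ψ : En (d+1) → ℂ) (x : En (d+1)) : ℂ :=
  (∑ i : Fin d, ∑ j : Fin d,
      iteratedFDeriv ℝ 4 ψ x
        ![stdB (d+1) i.castSucc, stdB (d+1) i.castSucc,
          stdB (d+1) j.castSucc, stdB (d+1) j.castSucc])
  + 2 * Real.cos γ *
    (∑ i : Fin d,
      iteratedFDeriv ℝ 4 ψ x
        ![stdB (d+1) i.castSucc, stdB (d+1) i.castSucc,
          stdB (d+1) (Fin.last d), stdB (d+1) (Fin.last d)])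
  + iteratedFDeriv ℝ 4 ψ x
      ![stdB (d+1) (Fin.last d), stdB (d+1) (Fin.last d),
        stdB (d+1) (Fin.last d), stdB (d+1) (Fin.last d)]

lemma it4_le {E G : Type*} [NormedAddCommGroup E] [NormedSpace ℝ E] [NormedAddCommGroup G] [NormedSpace ℝ G]
    (T : ContinuousMultilinearMap ℝ (fun _ : Fin 4 => E) G) (a b c e : E)
    (ha : ‖a‖ = 1) (hb : ‖b‖ = 1) (hc : ‖c‖ = 1) (he : ‖e‖ = 1) : ‖T ![a,b,c,e]‖ ≤ ‖T‖ := by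
  have := T.le_opNorm ![a,b,c,e]
  simpa [Fin.prod_univ_four, ha, hb, hc, he] using this

lemma stdB_norm (n : ℕ) (i : Fin n) : ‖stdB n i‖ = 1 := by simp [stdB]

lemma Lgamma_le (d : ℕ) (γ : ℝ) (ψ : En (d+1) → ℝ) (x : En (d+1)) :
    ‖Lgamma d γ ψ x‖ ≤ ((d:ℝ) * d + 2 * d + 1) * ‖iteratedFDeriv ℝ 4 ψ x‖ := by
  have key : ∀ i j : Fin (d+1), ‖iteratedFDeriv ℝ 4 ψ x
        ![stdB (d+1) i, stdB (d+1) i, stdB (d+1) j, stdB (d+1) j]‖ ≤ ‖iteratedFDeriv ℝ 4 ψ x‖ :=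
    fun i j => it4_le _ _ _ _ _ (stdB_norm _ _) (stdB_norm _ _) (stdB_norm _ _) (stdB_norm _ _)
  unfold Lgamma
  set K := ‖iteratedFDeriv ℝ 4 ψ x‖
  have hK : 0 ≤ K := norm_nonneg _
  refine (norm_add₃_le).trans ?_
  have h1 : ‖∑ i : Fin d, ∑ j : Fin d, iteratedFDeriv ℝ 4 ψ x
        ![stdB (d+1) i.castSucc, stdB (d+1) i.castSucc,
          stdB (d+1) j.castSucc, stdB (d+1) j.castSucc]‖ ≤ ∑ i : Fin d, ∑ j : Fin d, K := by
    refine norm_sum_le_of_le _ fun i _ => norm_sum_le_of_le _ fun j _ => key _ _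
  have h2 : ‖∑ i : Fin d, iteratedFDeriv ℝ 4 ψ x
        ![stdB (d+1) i.castSucc, stdB (d+1) i.castSucc,
          stdB (d+1) (Fin.last d), stdB (d+1) (Fin.last d)]‖ ≤ ∑ i : Fin d, K := by
    refine norm_sum_le_of_le _ fun i _ => key _ _
  have h3 := key (Fin.last d) (Fin.last d)
  simp only [Finset.sum_const, Finset.card_univ, Fintype.card_fin, nsmul_eq_mul] at h1 h2
  rw [norm_mul]
  have h4 : ‖2 * Real.cos γ‖ ≤ 2 := by
    rw [norm_mul, Real.norm_eq_abs, Real.norm_eq_abs, abs_two]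
    linarith [Real.abs_cos_le_one γ]
  have h5 := mul_le_mul h4 h2 (norm_nonneg _) (by norm_num)
  linarith

lemma Lgamma_meas (d : ℕ) (γ : ℝ) (ψ : En (d+1) → ℝ) (hψ : ContDiff ℝ (⊤ : ℕ∞) ψ) :
    Continuous (Lgamma d γ ψ) := by
  have h : Continuous (iteratedFDeriv ℝ 4 ψ) := hψ.continuous_iteratedFDeriv (nat_le_top' _)
  have h' : ∀ v : Fin 4 → En (d+1), Continuous (fun x => iteratedFDeriv ℝ 4 ψ x v) := fun v => by fun_prop
  unfold Lgamma
  refine Continuous.add (Continuous.add ?_ ?_) (h' _)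
  · exact continuous_finsetSum _ fun i _ => continuous_finsetSum _ fun j _ => h' _
  · exact continuous_const.mul (continuous_finsetSum _ fun i _ => h' _)

lemma ext_real (d : ℕ) (γ : ℝ) (F : En (d+1) → ℝ)
    (hFm : AEStronglyMeasurable F volume)
    (hFi : Integrable (fun y => F y * ((1 + ‖y‖) ^ (d+1))⁻¹) volume)
    (hFfund : ∀ ψ : En (d+1) → ℝ, ContDiff ℝ (⊤ : ℕ∞) ψ → HasCompactSupport ψ →
      ∫ y, F y * Lgamma d γ ψ y = ψ 0)
    (ψ : En (d+1) → ℝ) (hψ : ContDiff ℝ (⊤ : ℕ∞) ψ) (C : ℝ)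
    (hdec : ∀ i ≤ 4, ∀ y, ‖iteratedFDeriv ℝ i ψ y‖ ≤ C * ((1 + ‖y‖) ^ (d+1))⁻¹) :
    ∫ y, F y * Lgamma d γ ψ y = ψ 0 := by
  -- cutoff
  let bump : ContDiffBump (0 : En (d+1)) := ⟨1, 2, by norm_num, by norm_num⟩
  set χ : En (d+1) → ℝ := fun y => bump y with hχ
  have hχs : ContDiff ℝ (⊤ : ℕ∞) χ := bump.contDiff
  have hχc : HasCompactSupport χ := bump.hasCompactSupport
  obtain ⟨B, hB⟩ : ∃ B : ℝ, ∀ i ≤ 4, ∀ y, ‖iteratedFDeriv ℝ i χ y‖ ≤ B := by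
    have : ∀ i : ℕ, ∃ B : ℝ, ∀ y, ‖iteratedFDeriv ℝ i χ y‖ ≤ B := fun i =>
      (hχs.continuous_iteratedFDeriv (nat_le_top' _)).bounded_above_of_compact_support
        (hχc.iteratedFDeriv i)
    choose B hB using this
    refine ⟨∑ i ∈ Finset.range 5, |B i|, fun i hi y => (hB i y).trans ?_⟩
    refine (le_abs_self _).trans ?_
    exact Finset.single_le_sum (f := fun i => |B i|) (fun i _ => abs_nonneg _) (Finset.mem_range.2 (by omega))
  have hB0 : 0 ≤ B := (norm_nonneg _).trans (hB 0 (by norm_num) 0)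
  have hC0 : ∀ y : En (d+1), 0 ≤ C * ((1 + ‖y‖) ^ (d+1))⁻¹ := fun y => (norm_nonneg _).trans (hdec 0 (by norm_num) y)
  set ψN : ℕ → En (d+1) → ℝ := fun N y => χ (((N:ℝ)+1)⁻¹ • y) * ψ y with hψN
  have hχN : ∀ N : ℕ, ContDiff ℝ (⊤ : ℕ∞) (fun y => χ (((N:ℝ)+1)⁻¹ • y)) := fun N =>
    hχs.comp (contDiff_id.const_smul _)
  have hψNs : ∀ N, ContDiff ℝ (⊤ : ℕ∞) (ψN N) := fun N => (hχN N).mul hψ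
  have hψNc : ∀ N, HasCompactSupport (ψN N) := fun N => by
    apply HasCompactSupport.mul_right
    exact hχc.comp_smul (by positivity)
  have hχNb : ∀ N : ℕ, ∀ i ≤ 4, ∀ y, ‖iteratedFDeriv ℝ i (fun y => χ (((N:ℝ)+1)⁻¹ • y)) y‖ ≤ B := by
    intro N i hi y
    rw [iteratedFDeriv_comp_const_smul _ (hχs.of_le (nat_le_top' _))]
    simp only [norm_smul]
    refine (mul_le_of_le_one_left (norm_nonneg _) ?_).trans (hB i hi _)
    rw [norm_pow, Real.norm_of_nonneg (by positivity)]
    apply pow_le_one₀ (by positivity)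
    apply inv_le_one_of_one_le₀
    linarith [(Nat.cast_nonneg N : (0:ℝ) ≤ N)]
  have hbd : ∀ N y, ‖iteratedFDeriv ℝ 4 (ψN N) y‖ ≤ 16 * B * (C * ((1 + ‖y‖) ^ (d+1))⁻¹) := by
    intro N y
    refine (norm_iteratedFDeriv_mul_le (hχN N) hψ y (n := 4) (nat_le_top' _)).trans ?_
    have : ∀ i ∈ Finset.range (4+1), ((4:ℕ).choose i : ℝ) * ‖iteratedFDeriv ℝ i (fun y => χ (((N:ℝ)+1)⁻¹ • y)) y‖
        * ‖iteratedFDeriv ℝ (4 - i) ψ y‖ ≤ ((4:ℕ).choose i : ℝ) * B * (C * ((1 + ‖y‖) ^ (d+1))⁻¹) := by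
      intro i hi
      have h1 := hχNb N i (by simp at hi; omega) y
      have h2 := hdec (4 - i) (by omega) y
      gcongr
    refine (Finset.sum_le_sum this).trans (le_of_eq ?_)
    rw [← Finset.sum_mul, ← Finset.sum_mul]
    congr 2
    norm_num [Finset.sum_range_succ, Nat.choose]
  have hlim : Filter.Tendsto (fun N => ∫ y, F y * Lgamma d γ (ψN N) y) Filter.atTop
      (nhds (∫ y, F y * Lgamma d γ ψ y)) := by
    apply tendsto_integral_of_dominated_convergence
      (fun y => (((d:ℝ) * d + 2 * d + 1) * (16 * B * C)) * ‖F y * ((1 + ‖y‖) ^ (d+1))⁻¹‖)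
    · intro N
      exact hFm.mul (Lgamma_meas d γ _ (hψNs N)).aestronglyMeasurable
    · exact hFi.norm.const_mul _
    · intro N
      refine Filter.Eventually.of_forall fun y => ?_
      rw [norm_mul, norm_mul, Real.norm_of_nonneg (r := ((1 + ‖y‖) ^ (d+1))⁻¹) (by positivity)]
      have h1 := (Lgamma_le d γ (ψN N) y).trans (mul_le_mul_of_nonneg_left (hbd N y) (by positivity))
      calc ‖F y‖ * ‖Lgamma d γ (ψN N) y‖ ≤ ‖F y‖ * _ := mul_le_mul_of_nonneg_left h1 (norm_nonneg _)
        _ = _ := by ring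
    · refine Filter.Eventually.of_forall fun y => ?_
      apply tendsto_const_nhds.congr'
      obtain ⟨N0, hN0⟩ := exists_nat_gt ‖y‖
      filter_upwards [Filter.eventually_ge_atTop N0] with N hN
      have hN' : (N0:ℝ) ≤ N := by exact_mod_cast hN
      have hloc : ψN N =ᶠ[nhds y] ψ := by
        have : Metric.ball (0 : En (d+1)) (N+1) ∈ nhds y := by
          apply Metric.isOpen_ball.mem_nhds
          simp; linarith
        filter_upwards [this] with z hz
        have : χ (((N:ℝ)+1)⁻¹ • z) = 1 := by
          apply bump.one_of_mem_closedBall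
          simp only [Metric.mem_closedBall, dist_zero_right, norm_smul] at hz ⊢
          simp only [Metric.mem_ball, dist_zero_right] at hz
          rw [Real.norm_of_nonneg (by positivity), inv_mul_le_iff₀ (by positivity)]
          show _ ≤ _ * (1:ℝ)
          linarith
        simp [hψN, this]
      have := (hloc.iteratedFDeriv ℝ 4).eq_of_nhds
      simp only [Lgamma, this]
  have hcst : ∀ N, ∫ y, F y * Lgamma d γ (ψN N) y = ψ 0 := by
    intro N
    rw [hFfund _ (hψNs N) (hψNc N)]
    have : χ 0 = 1 := bump.one_of_mem_closedBall (by simp [bump])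
    simp [hψN, this]
  simp only [hcst] at hlim
  exact (tendsto_nhds_unique hlim tendsto_const_nhds)

lemma ext_complex (d : ℕ) (γ : ℝ) (F : En (d+1) → ℝ)
    (hFm : AEStronglyMeasurable F volume)
    (hFi : Integrable (fun y => F y * ((1 + ‖y‖) ^ (d+1))⁻¹) volume)
    (hFfund : ∀ ψ : En (d+1) → ℝ, ContDiff ℝ (⊤ : ℕ∞) ψ → HasCompactSupport ψ →
      ∫ y, F y * Lgamma d γ ψ y = ψ 0)
    (ψ : En (d+1) → ℂ) (hψ : ContDiff ℝ (⊤ : ℕ∞) ψ) (C : ℝ)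
    (hdec : ∀ i ≤ 4, ∀ y, ‖iteratedFDeriv ℝ i ψ y‖ ≤ C * ((1 + ‖y‖) ^ (d+1))⁻¹) :
    ∫ y, F y • LC d γ ψ y = ψ 0 := by
  have hn : ∀ (l : ℂ →L[ℝ] ℝ), ‖l‖ ≤ 1 → ∫ y, F y * Lgamma d γ (l ∘ ψ) y = l (ψ 0) := by
    intro l hl
    apply ext_real d γ F hFm hFi hFfund _ (l.contDiff.comp hψ) C
    intro i hi y
    refine (l.norm_iteratedFDeriv_comp_left hψ.contDiffAt (nat_le_top' _)).trans ?_
    exact (mul_le_of_le_one_left (norm_nonneg _) hl).trans (hdec i hi y)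
  have hcomp : ∀ (l : ℂ →L[ℝ] ℝ) y, l (LC d γ ψ y) = Lgamma d γ (l ∘ ψ) y := by
    intro l y
    have h4 : iteratedFDeriv ℝ 4 (l ∘ ψ) y = l.compContinuousMultilinearMap (iteratedFDeriv ℝ 4 ψ y) :=
      l.iteratedFDeriv_comp_left hψ.contDiffAt (i := 4) (nat_le_top' _)
    have hs : ∀ z : ℂ, l (2 * Real.cos γ * z) = 2 * Real.cos γ * l z := by
      intro z
      have : 2 * (Real.cos γ : ℂ) * z = (2 * Real.cos γ : ℝ) • z := by
        rw [Complex.real_smul]; push_cast; ring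
      rw [this, map_smul, smul_eq_mul]
    simp only [LC, Lgamma, h4, map_add, hs, map_sum, ContinuousLinearMap.compContinuousMultilinearMap_coe,
      Function.comp]
  have hLcont : Continuous (LC d γ ψ) := by
    have h : Continuous (iteratedFDeriv ℝ 4 ψ) := hψ.continuous_iteratedFDeriv (nat_le_top' _)
    have h' : ∀ v : Fin 4 → En (d+1), Continuous (fun x => iteratedFDeriv ℝ 4 ψ x v) := fun v => by fun_prop
    unfold LC
    refine Continuous.add (Continuous.add ?_ ?_) (h' _)
    · exact continuous_finsetSum _ fun i _ => continuous_finsetSum _ fun j _ => h' _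
    · exact continuous_const.mul (continuous_finsetSum _ fun i _ => h' _)
  have hre1 : ‖Complex.reCLM‖ ≤ 1 := by simp
  have him1 : ‖Complex.imCLM‖ ≤ 1 := by simp
  have hLb : ∀ (l : ℂ →L[ℝ] ℝ), ‖l‖ ≤ 1 → ∀ y, ‖Lgamma d γ (l ∘ ψ) y‖ ≤ (((d:ℝ) * d + 2 * d + 1) * C) * ((1 + ‖y‖) ^ (d+1))⁻¹ := by
    intro l hl y
    refine (Lgamma_le _ _ _ _).trans ?_
    rw [mul_assoc]
    apply mul_le_mul_of_nonneg_left _ (by positivity)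
    refine (l.norm_iteratedFDeriv_comp_left hψ.contDiffAt (n := 4) (nat_le_top' _)).trans ?_
    exact (mul_le_of_le_one_left (norm_nonneg _) hl).trans (hdec 4 le_rfl y)
  have hint : Integrable (fun y => F y • LC d γ ψ y) volume := by
    apply F_mul_int hFm hFi _ hLcont.aestronglyMeasurable (2 * (((d:ℝ) * d + 2 * d + 1) * C))
    intro y
    have h1 := hLb _ hre1 y
    have h2 := hLb _ him1 y
    rw [← hcomp] at h1 h2
    refine (Complex.norm_le_abs_re_add_abs_im _).trans ?_
    simp only [Complex.reCLM_apply, Complex.imCLM_apply, Real.norm_eq_abs] at h1 h2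
    linarith
  have hfin : ∀ (l : ℂ →L[ℝ] ℝ), ‖l‖ ≤ 1 → l (∫ y, F y • LC d γ ψ y) = l (ψ 0) := by
    intro l hl
    rw [← ContinuousLinearMap.integral_comp_comm _ hint, ← hn l hl]
    congr 1; ext y
    rw [map_smul, hcomp, smul_eq_mul]
  apply Complex.ext
  · exact hfin _ hre1
  · exact hfin _ him1




/-- coordinate difference -/
def zc (n : ℕ) (x : En n) (k : Fin n) (y : En n) : ℂ := ((y k - x k : ℝ) : ℂ)

def gq (n : ℕ) (c : Fin n → ℂ) (x y : En n) : ℂ := - ∑ k, c k * (zc n x k y) ^ 2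

def gs (n : ℕ) (K : ℂ) (c : Fin n → ℂ) (x y : En n) : ℂ := K * Complex.exp (gq n c x y)

lemma zc_tg (n : ℕ) (x : En n) (k : Fin n) : Function.HasTemperateGrowth (zc n x k) := by
  have h1 : Function.HasTemperateGrowth (fun y : En n => ((EuclideanSpace.proj k : En n →L[ℝ] ℝ) y : ℂ)) :=
    (Complex.ofRealCLM.comp (EuclideanSpace.proj k : En n →L[ℝ] ℝ)).hasTemperateGrowth
  have h2 := h1.sub (Function.HasTemperateGrowth.const (E := En n) (x k : ℂ))
  convert! h2 using 1
  ext y; simp [zc]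

lemma gq_tg (n : ℕ) (c : Fin n → ℂ) (x : En n) : Function.HasTemperateGrowth (gq n c x) := by
  have h : Function.HasTemperateGrowth (fun y => ∑ k ∈ Finset.univ, (fun y => c k * (zc n x k y) ^ 2) y) := by
    apply Function.HasTemperateGrowth.sum
    intro k _
    exact (Function.HasTemperateGrowth.const (c k)).mul ((zc_tg n x k).pow 2)
  exact h.neg

lemma gs_smooth (n : ℕ) (K : ℂ) (c : Fin n → ℂ) (x : En n) : ContDiff ℝ (⊤ : ℕ∞) (gs n K c x) := by
  have h : ContDiff ℝ (⊤ : ℕ∞) (gq n c x) := (gq_tg n c x).1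
  unfold gs
  exact contDiff_const.mul h.cexp

lemma cexp_it (i : ℕ) (z : ℂ) :
    ‖iteratedFDeriv ℝ i Complex.exp z‖ ≤ ‖Complex.exp z‖ * ‖iteratedFDeriv ℝ i Complex.exp 0‖ := by
  have hs : ContDiff ℝ i Complex.exp := Complex.contDiff_exp
  have h := iteratedFDeriv_comp_add_left (𝕜 := ℝ) (f := Complex.exp) i z 0
  rw [add_zero] at h
  rw [← h]
  have h2 : (fun w => Complex.exp (z + w)) = (ContinuousLinearMap.mul ℝ ℂ (Complex.exp z)) ∘ Complex.exp := by
    ext w; simp [Complex.exp_add]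
  rw [h2]
  refine (ContinuousLinearMap.norm_iteratedFDeriv_comp_left _ hs.contDiffAt le_rfl).trans ?_
  gcongr
  simp

lemma gq_re (n : ℕ) (c : Fin n → ℂ) (x y : En n) (δ : ℝ) (hc : ∀ k, δ ≤ (c k).re) :
    (gq n c x y).re ≤ - (δ * ‖y - x‖ ^ 2) := by
  rw [EuclideanSpace.norm_sq_eq]
  simp only [gq, zc, Complex.neg_re, Complex.re_sum]
  rw [neg_le_neg_iff, Finset.mul_sum]
  apply Finset.sum_le_sum
  intro k _
  rw [← Complex.ofReal_pow, Complex.re_mul_ofReal]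
  have := hc k
  simp only [PiLp.sub_apply, Real.norm_eq_abs, sq_abs]
  gcongr

lemma wt_shift (n : ℕ) (x y : En n) (m : ℕ) : (1 + ‖y‖) ^ m ≤ (1 + ‖x‖) ^ m * (1 + ‖y - x‖) ^ m := by
  rw [← mul_pow]
  gcongr
  have := norm_add_le (y - x) x
  rw [sub_add_cancel] at this
  nlinarith [norm_nonneg x, norm_nonneg (y - x)]

lemma gauss_le (n m : ℕ) (x : En n) (δ : ℝ) (hδ : 0 < δ) : ∃ C : ℝ, 0 < C ∧ ∀ y : En n,
    Real.exp (-(δ * ‖y - x‖ ^ 2)) ≤ C * ((1 + ‖y‖) ^ m)⁻¹ := by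
  obtain ⟨C, hC, h⟩ := exp_bound m δ hδ
  refine ⟨C * (1 + ‖x‖) ^ m, by positivity, fun y => ?_⟩
  rw [le_mul_inv_iff₀ (by positivity), Real.exp_neg, inv_mul_le_iff₀ (by positivity)]
  have h1 := h _ (norm_nonneg (y - x))
  calc _ ≤ _ := wt_shift n x y m
    _ ≤ (1 + ‖x‖) ^ m * (C * Real.exp (δ * ‖y - x‖ ^ 2)) := by gcongr
    _ = _ := by ring

lemma gs_dec (n : ℕ) (K : ℂ) (c : Fin n → ℂ) (x : En n) (δ : ℝ) (hδ : 0 < δ) (hc : ∀ k, δ ≤ (c k).re) :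
    ∃ C : ℝ, ∀ i ≤ 4, ∀ y, ‖iteratedFDeriv ℝ i (gs n K c x) y‖ ≤ C * ((1 + ‖y‖) ^ n)⁻¹ := by
  obtain ⟨k, C1, hC1, hg⟩ := (gq_tg n c x).norm_iteratedFDeriv_le_uniform 4
  set E0 := ∑ i ∈ Finset.range 5, ‖iteratedFDeriv ℝ i Complex.exp 0‖ with hE0
  have hE : ∀ i ≤ 4, ‖iteratedFDeriv ℝ i Complex.exp 0‖ ≤ E0 := fun i hi =>
    Finset.single_le_sum (f := fun i => ‖iteratedFDeriv ℝ i Complex.exp 0‖) (fun i _ => norm_nonneg _)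
      (Finset.mem_range.2 (by omega))
  have hE0' : 0 ≤ E0 := Finset.sum_nonneg fun i _ => norm_nonneg _
  obtain ⟨C2, hC2, h2⟩ := gauss_le n (n + k * 4) x δ hδ
  refine ⟨‖K‖ * (24 * E0 * C2 * (C1 + 1) ^ 4), fun i hi y => ?_⟩
  have hgs : gs n K c x = (ContinuousLinearMap.mul ℝ ℂ K) ∘ (Complex.exp ∘ gq n c x) := by
    ext y; simp [gs]
  have hsm : ContDiff ℝ (⊤ : ℕ∞) (gq n c x) := (gq_tg n c x).1
  have hsm2 : ContDiff ℝ (⊤ : ℕ∞) (Complex.exp ∘ gq n c x) := hsm.cexp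
  rw [hgs]
  refine (ContinuousLinearMap.norm_iteratedFDeriv_comp_left _ hsm2.contDiffAt (nat_le_top' _)).trans ?_
  have hK : ‖ContinuousLinearMap.mul ℝ ℂ K‖ ≤ ‖K‖ := by simp
  rw [mul_assoc]
  apply mul_le_mul hK _ (norm_nonneg _) (norm_nonneg _)
  set D := (C1 + 1) * (1 + ‖y‖) ^ k with hD
  have hpow : 1 ≤ (1 + ‖y‖) ^ k := one_le_pow₀ (by linarith [norm_nonneg y])
  have hD1 : 1 ≤ D := by nlinarith
  have h3 := norm_iteratedFDeriv_comp_le (𝕜 := ℝ) (g := Complex.exp) (f := gq n c x) (n := i) (N := (⊤ : ℕ∞))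
    Complex.contDiff_exp hsm (nat_le_top' _) y (C := ‖Complex.exp (gq n c x y)‖ * E0) (D := D)
    (fun j hj => (cexp_it j _).trans (by gcongr; exact hE j (by omega)))
    (fun j h1 hj => by
      refine (hg j (by omega) y).trans ?_
      refine le_trans ?_ (le_self_pow₀ hD1 (by omega))
      rw [hD]; gcongr; linarith)
  refine h3.trans ?_
  have hfac : (i.factorial : ℝ) ≤ 24 := by
    have : i.factorial ≤ (4).factorial := Nat.factorial_le hi
    exact_mod_cast this
  have hDi : D ^ i ≤ D ^ 4 := pow_le_pow_right₀ hD1 hi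
  have hexp : ‖Complex.exp (gq n c x y)‖ ≤ C2 * ((1 + ‖y‖) ^ (n + k * 4))⁻¹ := by
    rw [Complex.norm_exp]
    exact (Real.exp_le_exp.2 (gq_re n c x y δ hc)).trans (h2 y)
  calc _ ≤ 24 * (C2 * ((1 + ‖y‖) ^ (n + k * 4))⁻¹ * E0) * D ^ 4 := by
        apply mul_le_mul _ hDi (by positivity) (by positivity)
        gcongr
    _ = _ := by
        rw [hD, mul_pow, pow_add, ← pow_mul, mul_inv]
        have : (1 + ‖y‖) ^ (k * 4) ≠ 0 := by positivity
        field_simp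

/-! explicit derivatives -/
lemma zc_hasFDeriv (n : ℕ) (x : En n) (k : Fin n) (y : En n) :
    HasFDerivAt (zc n x k) (Complex.ofRealCLM.comp (EuclideanSpace.proj k : En n →L[ℝ] ℝ)) y := by
  have h1 := (Complex.ofRealCLM.comp (EuclideanSpace.proj k : En n →L[ℝ] ℝ)).hasFDerivAt (x := y)
  convert! h1.sub_const (x k : ℂ) using 1
  ext y; simp [zc]

lemma zc_diff (n : ℕ) (x : En n) (k : Fin n) : Differentiable ℝ (zc n x k) :=
  fun y => (zc_hasFDeriv n x k y).differentiableAt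

lemma zc_fderiv (n : ℕ) (x : En n) (k : Fin n) (y : En n) (i : Fin n) :
    fderiv ℝ (zc n x k) y (stdB n i) = if k = i then 1 else 0 := by
  rw [(zc_hasFDeriv n x k y).fderiv]
  simp [stdB]
  split_ifs <;> simp

lemma gs_diff (n : ℕ) (K : ℂ) (c : Fin n → ℂ) (x : En n) : Differentiable ℝ (gs n K c x) :=
  (gs_smooth n K c x).differentiable (by simp)

lemma gs_fderiv (n : ℕ) (K : ℂ) (c : Fin n → ℂ) (x y : En n) (i : Fin n) :
    fderiv ℝ (gs n K c x) y (stdB n i) = -2 * c i * zc n x i y * gs n K c x y := by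
  have h1 : ∀ k, HasFDerivAt (fun y => c k * (zc n x k y) ^ 2) _ y := fun k =>
    ((zc_hasFDeriv n x k y).pow 2).const_mul (c k)
  have h2 : HasFDerivAt (gq n c x) _ y := (HasFDerivAt.fun_sum (u := Finset.univ) fun k _ => h1 k).neg
  have h3 : HasFDerivAt (gs n K c x) _ y := (h2.cexp).const_mul K
  rw [h3.fderiv]
  have h5 : ∀ k : Fin n, (((if k = i then 1 else 0 : ℝ)) : ℂ) = if k = i then 1 else 0 := by
    intro k; split_ifs <;> simp
  simp [stdB, gs, h5]
  ring

lemma it4_eq {E : Type*} [NormedAddCommGroup E] [NormedSpace ℝ E] (f : E → ℂ)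
    (hf : ContDiff ℝ (⊤ : ℕ∞) f) (a b c e y : E) :
    iteratedFDeriv ℝ 4 f y ![a, b, c, e] =
      fderiv ℝ (fun y => fderiv ℝ (fun y => fderiv ℝ (fun y => fderiv ℝ f y e) y c) y b) y a := by
  have key : ∀ (m : ℕ) (y : E) (v : Fin (m+1) → E), iteratedFDeriv ℝ (m+1) f y v =
      fderiv ℝ (fun y => iteratedFDeriv ℝ m f y (Fin.tail v)) y (v 0) := by
    intro m y v
    rw [iteratedFDeriv_succ_apply_left, fderiv_continuousMultilinear_apply_const_apply]
    apply (hf.differentiable_iteratedFDeriv (m := m) _).differentiableAt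
    exact_mod_cast (ENat.natCast_lt_top m)
  rw [key]
  have e1 : Fin.tail ![a, b, c, e] = ![b, c, e] := by ext i; fin_cases i <;> rfl
  have e2 : Fin.tail ![b, c, e] = ![c, e] := by ext i; fin_cases i <;> rfl
  have e3 : Fin.tail ![c, e] = ![e] := by ext i; fin_cases i; rfl
  simp only [e1, key, e2, e3]
  simp

def pk (n : ℕ) (c : Fin n → ℂ) (x : En n) (k : Fin n) (y : En n) : ℂ :=
  4 * c k ^ 2 * zc n x k y ^ 2 - 2 * c k

lemma gs_d4 (n : ℕ) (K : ℂ) (c : Fin n → ℂ) (x y : En n) (i j : Fin n) :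
    iteratedFDeriv ℝ 4 (gs n K c x) y ![stdB n i, stdB n i, stdB n j, stdB n j] =
      (pk n c x i y * pk n c x j y + if j = i then -32 * c i ^ 3 * zc n x i y ^ 2 + 8 * c i ^ 2 else 0)
        * gs n K c x y := by
  rw [it4_eq _ (gs_smooth n K c x)]
  have hz := fun k => zc_diff n x k
  have hg := gs_diff n K c x
  have e1 : (fun y => fderiv ℝ (gs n K c x) y (stdB n j)) = fun y => (-2 * c j) * (zc n x j y * gs n K c x y) := by
    ext y; rw [gs_fderiv]; ring
  have e2 : (fun y => fderiv ℝ (fun y => (-2 * c j) * (zc n x j y * gs n K c x y)) y (stdB n j))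
      = fun y => (4 * c j ^ 2 * (zc n x j y * zc n x j y) - 2 * c j) * gs n K c x y := by
    ext y
    rw [fderiv_const_mul (by fun_prop), fderiv_fun_mul (by fun_prop) (by fun_prop)]
    simp [gs_fderiv, zc_fderiv]
    ring
  have hP : ∀ y, fderiv ℝ (fun y => 4 * c j ^ 2 * (zc n x j y * zc n x j y) - 2 * c j) y (stdB n i)
      = if j = i then 8 * c j ^ 2 * zc n x j y else 0 := by
    intro y
    rw [fderiv_sub_const, fderiv_const_mul (by fun_prop), fderiv_fun_mul (by fun_prop) (by fun_prop)]
    simp [zc_fderiv]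
    split_ifs <;> ring
  have e3 : (fun y => fderiv ℝ (fun y => (4 * c j ^ 2 * (zc n x j y * zc n x j y) - 2 * c j) * gs n K c x y) y (stdB n i))
      = fun y => ((4 * c j ^ 2 * (zc n x j y * zc n x j y) - 2 * c j) * (-2 * c i * zc n x i y)
         + if j = i then 8 * c j ^ 2 * zc n x j y else 0) * gs n K c x y := by
    ext y
    rw [fderiv_fun_mul (by fun_prop) (by fun_prop)]
    simp only [_root_.add_apply, _root_.smul_apply, hP, gs_fderiv, smul_eq_mul]
    ring
  rw [e1, e2, e3]
  have hQ : fderiv ℝ (fun y => ((4 * c j ^ 2 * (zc n x j y * zc n x j y) - 2 * c j) * (-2 * c i * zc n x i y)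
         + if j = i then 8 * c j ^ 2 * zc n x j y else 0)) y (stdB n i)
      = (4 * c j ^ 2 * (zc n x j y * zc n x j y) - 2 * c j) * (-2 * c i) +
        if j = i then 8 * c j ^ 2 * zc n x j y * (-2 * c i * zc n x i y) + 8 * c j ^ 2 else 0 := by
    by_cases h : j = i
    · simp only [h, if_true]
      rw [fderiv_fun_add (by fun_prop) (by fun_prop), fderiv_fun_mul (by fun_prop) (by fun_prop),
        fderiv_const_mul (by fun_prop), fderiv_const_mul (by fun_prop)]
      subst h
      simp only [_root_.add_apply, _root_.smul_apply, hP, zc_fderiv, smul_eq_mul, if_true]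
      ring
    · simp only [h, if_false, add_zero]
      rw [fderiv_fun_mul (by fun_prop) (by fun_prop),
        fderiv_const_mul (by fun_prop)]
      simp only [_root_.add_apply, _root_.smul_apply, hP, zc_fderiv, smul_eq_mul, if_true, h, if_false]
      ring
  rw [fderiv_fun_mul _ hg.differentiableAt]
  · simp only [_root_.add_apply, _root_.smul_apply, hQ, gs_fderiv, smul_eq_mul, pk]
    split_ifs with h
    · subst h; ring
    · ring
  · split_ifs <;> fun_prop




def om (γ : ℝ) : ℂ := Complex.exp ((γ / 2 : ℝ) * Complex.I)
def omb (γ : ℝ) : ℂ := Complex.exp (-((γ / 2 : ℝ) * Complex.I))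
def al (γ s t : ℝ) : ℂ := s * omb γ + t * om γ
def be (γ s t : ℝ) : ℂ := s * om γ + t * omb γ
def K0 (d : ℕ) : ℝ := (4 * Real.pi) ^ (-((d + 1 : ℝ) / 2))
def Ph (d : ℕ) (γ r w s t : ℝ) : ℂ :=
  -((d / 2 : ℝ) : ℂ) * Complex.log (al γ s t) - (1 / 2 : ℂ) * Complex.log (be γ s t)
    - r * (1 / (4 * al γ s t)) - w * (1 / (4 * be γ s t))
def HH (d : ℕ) (γ r w s t : ℝ) : ℂ := K0 d * Complex.exp (Ph d γ r w s t)
def PP (d : ℕ) (γ r s t : ℝ) : ℂ := r / (4 * al γ s t ^ 2) - d / (2 * al γ s t)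
def QQ (γ w s t : ℝ) : ℂ := w / (4 * be γ s t ^ 2) - 1 / (2 * be γ s t)
def LL (d : ℕ) (γ r w s t : ℝ) : ℂ :=
  (PP d γ r s t ^ 2 + 2 * Real.cos γ * PP d γ r s t * QQ γ w s t + QQ γ w s t ^ 2
    + (- r / (2 * al γ s t ^ 3) + d / (2 * al γ s t ^ 2))
    + (- w / (2 * be γ s t ^ 3) + 1 / (2 * be γ s t ^ 2))) * HH d γ r w s t

lemma om_re (γ : ℝ) : (om γ).re = Real.cos (γ / 2) := by
  rw [om, Complex.exp_ofReal_mul_I_re]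
lemma om_im (γ : ℝ) : (om γ).im = Real.sin (γ / 2) := by
  rw [om, Complex.exp_ofReal_mul_I_im]
lemma omb_conj (γ : ℝ) : omb γ = (starRingEnd ℂ) (om γ) := by
  rw [om, omb, ← Complex.exp_conj, map_mul, Complex.conj_ofReal, Complex.conj_I, mul_neg]
lemma omb_re (γ : ℝ) : (omb γ).re = Real.cos (γ / 2) := by
  rw [omb_conj, Complex.conj_re, om_re]
lemma om_norm (γ : ℝ) : ‖om γ‖ = 1 := by rw [om, Complex.norm_exp_ofReal_mul_I]
lemma omb_norm (γ : ℝ) : ‖omb γ‖ = 1 := by rw [omb_conj, RCLike.norm_conj, om_norm]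
lemma om_mul (γ : ℝ) : om γ * omb γ = 1 := by rw [om, omb, ← Complex.exp_add]; simp
lemma om_sq (γ : ℝ) : om γ ^ 2 + omb γ ^ 2 = 2 * Real.cos γ := by
  rw [om, omb, ← Complex.exp_nat_mul, ← Complex.exp_nat_mul, Complex.ofReal_cos, Complex.two_cos]
  congr 2 <;> push_cast <;> ring
lemma om_sq' (γ : ℝ) : omb γ ^ 2 - om γ ^ 2 = - (2 * Complex.I * Real.sin γ) := by
  rw [om, omb, ← Complex.exp_nat_mul, ← Complex.exp_nat_mul, Complex.ofReal_sin]
  have := Complex.two_sin (γ : ℂ)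
  rw [show 2 * Complex.I * Complex.sin γ = Complex.I * (2 * Complex.sin γ) by ring, this]
  rw [show (2 : ℕ) * -(((γ / 2 : ℝ) : ℂ) * Complex.I) = -γ * Complex.I by push_cast; ring,
    show (2 : ℕ) * (((γ / 2 : ℝ) : ℂ) * Complex.I) = γ * Complex.I by push_cast; ring]
  linear_combination (Complex.exp (-γ * Complex.I) - Complex.exp (γ * Complex.I)) * Complex.I_sq

lemma be_conj (γ s t : ℝ) : be γ s t = (starRingEnd ℂ) (al γ s t) := by
  simp [be, al, omb_conj]
lemma al_re (γ s t : ℝ) : (al γ s t).re = Real.cos (γ / 2) * (s + t) := by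
  simp [al, om_re, omb_re]; ring
lemma be_re (γ s t : ℝ) : (be γ s t).re = Real.cos (γ / 2) * (s + t) := by
  rw [be_conj, Complex.conj_re, al_re]
lemma be_norm (γ s t : ℝ) : ‖be γ s t‖ = ‖al γ s t‖ := by
  rw [be_conj, RCLike.norm_conj]
lemma al_le (γ s t : ℝ) (hs : 0 ≤ s) (ht : 0 ≤ t) : ‖al γ s t‖ ≤ s + t := by
  refine (norm_add_le _ _).trans ?_
  simp [om_norm, omb_norm, abs_of_nonneg hs, abs_of_nonneg ht]
lemma al_ge (γ s t : ℝ) : Real.cos (γ / 2) * (s + t) ≤ ‖al γ s t‖ := by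
  rw [← al_re]; exact Complex.re_le_norm _

lemma kap_pos {γ : ℝ} (hγ : γ ∈ Set.Ioo 0 Real.pi) : 0 < Real.cos (γ / 2) :=
  Real.cos_pos_of_mem_Ioo ⟨by linarith [hγ.1, Real.pi_pos], by linarith [hγ.2]⟩

lemma al_re_pos {γ : ℝ} (hγ : γ ∈ Set.Ioo 0 Real.pi) {s t : ℝ} (h : 0 < s + t) : 0 < (al γ s t).re := by
  rw [al_re]; exact mul_pos (kap_pos hγ) h
lemma be_re_pos {γ : ℝ} (hγ : γ ∈ Set.Ioo 0 Real.pi) {s t : ℝ} (h : 0 < s + t) : 0 < (be γ s t).re := by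
  rw [be_re]; exact mul_pos (kap_pos hγ) h
lemma al_slit {γ : ℝ} (hγ : γ ∈ Set.Ioo 0 Real.pi) {s t : ℝ} (h : 0 < s + t) : al γ s t ∈ Complex.slitPlane :=
  Or.inl (al_re_pos hγ h)
lemma be_slit {γ : ℝ} (hγ : γ ∈ Set.Ioo 0 Real.pi) {s t : ℝ} (h : 0 < s + t) : be γ s t ∈ Complex.slitPlane :=
  Or.inl (be_re_pos hγ h)
lemma al_ne {γ : ℝ} (hγ : γ ∈ Set.Ioo 0 Real.pi) {s t : ℝ} (h : 0 < s + t) : al γ s t ≠ 0 :=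
  Complex.slitPlane_ne_zero (al_slit hγ h)
lemma be_ne {γ : ℝ} (hγ : γ ∈ Set.Ioo 0 Real.pi) {s t : ℝ} (h : 0 < s + t) : be γ s t ≠ 0 :=
  Complex.slitPlane_ne_zero (be_slit hγ h)

lemma inv_al_re {γ : ℝ} (hγ : γ ∈ Set.Ioo 0 Real.pi) {s t : ℝ} (hs : 0 ≤ s) (ht : 0 ≤ t) (h : 0 < s + t) :
    Real.cos (γ / 2) / (4 * (s + t)) ≤ (1 / (4 * al γ s t)).re := by
  have hk := kap_pos hγ
  have h1 : (1 / (4 * al γ s t)).re = (al γ s t).re / (4 * ‖al γ s t‖ ^ 2) := by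
    rw [one_div, Complex.inv_re, Complex.normSq_eq_norm_sq, norm_mul, mul_pow]
    have : ((4 : ℂ) * al γ s t).re = 4 * (al γ s t).re := by simp
    rw [this]
    have h2 : ‖al γ s t‖ ≠ 0 := by simpa using al_ne hγ h
    norm_num
    field_simp
    norm_num
    ring
  rw [h1, al_re]
  have h3 : 0 < ‖al γ s t‖ := by simpa using al_ne hγ h
  rw [div_le_div_iff₀ (by positivity) (by positivity)]
  have h4 : ‖al γ s t‖ ^ 2 ≤ (s + t) ^ 2 := by
    gcongr; exact al_le γ s t hs ht
  nlinarith

lemma inv_be_re {γ : ℝ} (s t : ℝ) : (1 / (4 * be γ s t)).re = (1 / (4 * al γ s t)).re := by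
  have : 1 / (4 * be γ s t) = (starRingEnd ℂ) (1 / (4 * al γ s t)) := by
    rw [be_conj, map_div₀, map_mul, map_one, map_ofNat]
  rw [this, Complex.conj_re]

lemma K0_pos (d : ℕ) : 0 < K0 d := by unfold K0; positivity

lemma HH_norm_le {d : ℕ} {γ : ℝ} (hγ : γ ∈ Set.Ioo 0 Real.pi) {r w s t : ℝ} (hs : 0 ≤ s) (ht : 0 ≤ t) (h : 0 < s + t)
    (hr : 0 ≤ r) (hw : 0 ≤ w) :
    ‖HH d γ r w s t‖ ≤ (K0 d * Real.cos (γ / 2) ^ (-((d + 1 : ℝ) / 2))) * (s + t) ^ (-((d + 1 : ℝ) / 2))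
      * Real.exp (-(Real.cos (γ / 2) / (4 * (s + t)) * (r + w))) := by
  have hk := kap_pos hγ
  have h3 : 0 < ‖al γ s t‖ := by simpa using al_ne hγ h
  rw [HH, norm_mul, Complex.norm_exp, Complex.norm_real, Real.norm_of_nonneg (K0_pos d).le]
  have e1 : (Ph d γ r w s t).re = -((d + 1 : ℝ) / 2) * Real.log ‖al γ s t‖ - (1 / (4 * al γ s t)).re * (r + w) := by
    simp only [Ph, Complex.sub_re]
    rw [← Complex.ofReal_neg, Complex.re_ofReal_mul, Complex.re_ofReal_mul, Complex.re_ofReal_mul,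
      inv_be_re, show (1 / 2 : ℂ) = ((1 / 2 : ℝ) : ℂ) by push_cast; rfl, Complex.re_ofReal_mul,
      Complex.log_re, Complex.log_re, be_norm]
    ring
  rw [e1, sub_eq_add_neg, Real.exp_add, mul_assoc (K0 d), mul_assoc (K0 d), mul_comm _ (Real.log _),
    ← Real.rpow_def_of_pos h3, ← Real.mul_rpow hk.le h.le]
  apply mul_le_mul_of_nonneg_left _ (K0_pos d).le
  apply mul_le_mul
  · apply Real.rpow_le_rpow_of_nonpos (by positivity) (al_ge γ s t)
    have : (0:ℝ) ≤ d := Nat.cast_nonneg d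
    linarith
  · apply Real.exp_le_exp.2
    apply neg_le_neg
    apply mul_le_mul_of_nonneg_right (inv_al_re hγ hs ht h) (by positivity)
  · positivity
  · positivity

/-! derivatives in s, t -/
lemma al_ds (γ s t : ℝ) : HasDerivAt (fun s => al γ s t) (omb γ) s := by
  have := ((Complex.ofRealCLM.hasDerivAt (x := s)).mul_const (omb γ)).add_const ((t:ℂ) * om γ)
  simpa [al] using this
lemma be_ds (γ s t : ℝ) : HasDerivAt (fun s => be γ s t) (om γ) s := by
  have := ((Complex.ofRealCLM.hasDerivAt (x := s)).mul_const (om γ)).add_const ((t:ℂ) * omb γ)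
  simpa [be] using this
lemma al_dt (γ s t : ℝ) : HasDerivAt (fun t => al γ s t) (om γ) t := by
  have := ((Complex.ofRealCLM.hasDerivAt (x := t)).mul_const (om γ)).const_add ((s:ℂ) * omb γ)
  simpa [al] using this
lemma be_dt (γ s t : ℝ) : HasDerivAt (fun t => be γ s t) (omb γ) t := by
  have := ((Complex.ofRealCLM.hasDerivAt (x := t)).mul_const (omb γ)).const_add ((s:ℂ) * om γ)
  simpa [be] using this

lemma gen_deriv (d : ℕ) (r w : ℝ) (K : ℂ) (A B : ℝ → ℂ) (A' B' : ℂ) (u : ℝ) (hA : HasDerivAt A A' u) (hB : HasDerivAt B B' u)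
    (hAs : A u ∈ Complex.slitPlane) (hBs : B u ∈ Complex.slitPlane) :
    HasDerivAt (fun u => K * Complex.exp (-((d / 2 : ℝ) : ℂ) * Complex.log (A u) - (1 / 2 : ℂ) * Complex.log (B u)
    - r * (1 / (4 * A u)) - w * (1 / (4 * B u))))
     ((A' * (r / (4 * A u ^ 2) - d / (2 * A u)) + B' * (w / (4 * B u ^ 2) - 1 / (2 * B u))) *
     (K * Complex.exp (-((d / 2 : ℝ) : ℂ) * Complex.log (A u) - (1 / 2 : ℂ) * Complex.log (B u)
    - r * (1 / (4 * A u)) - w * (1 / (4 * B u))))) u := by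
  have hA0 := Complex.slitPlane_ne_zero hAs
  have hB0 := Complex.slitPlane_ne_zero hBs
  have h1 := ((((hA.clog_real hAs).const_mul (-((d / 2 : ℝ) : ℂ))).sub ((hB.clog_real hBs).const_mul (1 / 2 : ℂ))).sub
    ((((hA.const_mul 4).fun_inv (by simpa using hA0)).const_mul (r : ℂ)))).sub
    ((((hB.const_mul 4).fun_inv (by simpa using hB0)).const_mul (w : ℂ)))
  have h2 := h1.cexp.const_mul K
  convert! h2 using 1
  · ext u; simp
  · simp only [one_div, Pi.sub_apply]
    push_cast
    field_simp
    ring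

lemma HH_ds {d : ℕ} {γ : ℝ} (hγ : γ ∈ Set.Ioo 0 Real.pi) {r w s t : ℝ} (h : 0 < s + t) :
    HasDerivAt (fun s => HH d γ r w s t) ((omb γ * PP d γ r s t + om γ * QQ γ w s t) * HH d γ r w s t) s :=
  gen_deriv d r w (K0 d) _ _ _ _ s (al_ds γ s t) (be_ds γ s t) (al_slit hγ h) (be_slit hγ h)

lemma HH_dt {d : ℕ} {γ : ℝ} (hγ : γ ∈ Set.Ioo 0 Real.pi) {r w s t : ℝ} (h : 0 < s + t) :
    HasDerivAt (fun t => HH d γ r w s t) ((om γ * PP d γ r s t + omb γ * QQ γ w s t) * HH d γ r w s t) t :=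
  gen_deriv d r w (K0 d) _ _ _ _ t (al_dt γ s t) (be_dt γ s t) (al_slit hγ h) (be_slit hγ h)

lemma HH_dst {d : ℕ} {γ : ℝ} (hγ : γ ∈ Set.Ioo 0 Real.pi) {r w s t : ℝ} (h : 0 < s + t) :
    HasDerivAt (fun t => (omb γ * PP d γ r s t + om γ * QQ γ w s t) * HH d γ r w s t) (LL d γ r w s t) t := by
  have hA0 := al_ne hγ h
  have hB0 := be_ne hγ h
  have hP : HasDerivAt (fun t => PP d γ r s t) (om γ * (- r / (2 * al γ s t ^ 3) + d / (2 * al γ s t ^ 2))) t := by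
    have h1 := (((((al_dt γ s t).fun_pow 2).const_mul 4).fun_inv (by simpa using hA0)).const_mul (r : ℂ)).sub
      ((((al_dt γ s t).const_mul 2).fun_inv (by simpa using hA0)).const_mul (d : ℂ))
    convert! h1 using 1
    push_cast; field_simp; ring
  have hQ : HasDerivAt (fun t => QQ γ w s t) (omb γ * (- w / (2 * be γ s t ^ 3) + 1 / (2 * be γ s t ^ 2))) t := by
    have h1 := (((((be_dt γ s t).fun_pow 2).const_mul 4).fun_inv (by simpa using hB0)).const_mul (w : ℂ)).sub
      ((((be_dt γ s t).const_mul 2).fun_inv (by simpa using hB0)))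
    convert! h1 using 1
    · ext t; simp [QQ]; ring
    · push_cast; field_simp; ring
  have h2 := ((hP.const_mul (omb γ)).fun_add (hQ.const_mul (om γ))).fun_mul (HH_dt (d := d) (r := r) (w := w) hγ h)
  convert! h2 using 1
  rw [LL]
  set P := PP d γ r s t
  set Q := QQ γ w s t
  have e1 := om_mul γ
  have e2 := om_sq γ
  generalize (- r / (2 * al γ s t ^ 3) + d / (2 * al γ s t ^ 2)) = P'
  generalize (- w / (2 * be γ s t ^ 3) + 1 / (2 * be γ s t ^ 2)) = Q'
  generalize HH d γ r w s t = H
  generalize om γ = o at *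
  generalize omb γ = o' at *
  linear_combination (-(P^2 + Q^2 + P' + Q') * H) * e1 - P * Q * H * e2




def rr (d : ℕ) (x y : En (d+1)) : ℝ := ∑ i : Fin d, (y i.castSucc - x i.castSucc) ^ 2
def ww (d : ℕ) (x y : En (d+1)) : ℝ := (y (Fin.last d) - x (Fin.last d)) ^ 2

lemma rr_nonneg (d : ℕ) (x y : En (d+1)) : 0 ≤ rr d x y := Finset.sum_nonneg fun _ _ => sq_nonneg _
lemma ww_nonneg (d : ℕ) (x y : En (d+1)) : 0 ≤ ww d x y := sq_nonneg _
lemma rr_ww (d : ℕ) (x y : En (d+1)) : rr d x y + ww d x y = ‖y - x‖ ^ 2 := by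
  rw [EuclideanSpace.norm_sq_eq, Fin.sum_univ_castSucc]; simp [rr, ww]
lemma rr_cont (d : ℕ) (x : En (d+1)) : Continuous (rr d x) := by unfold rr; fun_prop
lemma ww_cont (d : ℕ) (x : En (d+1)) : Continuous (ww d x) := by unfold ww; fun_prop

def cv (d : ℕ) (γ s t : ℝ) : Fin (d+1) → ℂ :=
  Fin.snoc (α := fun _ => ℂ) (fun _ => 1 / (4 * al γ s t)) (1 / (4 * be γ s t))

def Kv (d : ℕ) (γ s t : ℝ) : ℂ := K0 d * Complex.exp (-((d / 2 : ℝ) : ℂ) * Complex.log (al γ s t)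
    - (1 / 2 : ℂ) * Complex.log (be γ s t))

lemma cv_cast (d : ℕ) (γ s t : ℝ) (i : Fin d) : cv d γ s t i.castSucc = 1 / (4 * al γ s t) := by
  simp [cv]
lemma cv_last (d : ℕ) (γ s t : ℝ) : cv d γ s t (Fin.last d) = 1 / (4 * be γ s t) := by
  simp [cv]

lemma gs_eq (d : ℕ) (γ s t : ℝ) (x y : En (d+1)) :
    gs (d+1) (Kv d γ s t) (cv d γ s t) x y = HH d γ (rr d x y) (ww d x y) s t := by
  rw [gs, HH, Kv, mul_assoc, ← Complex.exp_add, Ph, gq, Fin.sum_univ_castSucc]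
  simp only [cv_cast, cv_last, ← Finset.mul_sum, rr, ww, zc]
  push_cast
  congr 2
  ring

lemma LC_gs {d : ℕ} {γ : ℝ} (hγ : γ ∈ Set.Ioo 0 Real.pi) {s t : ℝ} (h : 0 < s + t) (x y : En (d+1)) :
    LC d γ (gs (d+1) (Kv d γ s t) (cv d γ s t) x) y = LL d γ (rr d x y) (ww d x y) s t := by
  have hA := al_ne hγ h
  have hB := be_ne hγ h
  unfold LC
  simp only [gs_d4, gs_eq]
  have e1 : ∑ i : Fin d, pk (d+1) (cv d γ s t) x i.castSucc y = PP d γ (rr d x y) s t := by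
    simp only [pk, cv_cast, Finset.sum_sub_distrib, ← Finset.mul_sum, PP, rr, zc]
    simp
    field_simp
    ring
  have e2 : pk (d+1) (cv d γ s t) x (Fin.last d) y = QQ γ (ww d x y) s t := by
    simp only [pk, cv_last, QQ, ww, zc]
    push_cast
    field_simp
    ring
  have e3 : ∑ i : Fin d, (-32 * cv d γ s t i.castSucc ^ 3 * zc (d+1) x i.castSucc y ^ 2 + 8 * cv d γ s t i.castSucc ^ 2) =
      (- (rr d x y : ℂ) / (2 * al γ s t ^ 3) + d / (2 * al γ s t ^ 2)) := by
    simp only [cv_cast, Finset.sum_add_distrib, ← Finset.mul_sum, rr, zc]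
    simp
    field_simp
    ring
  have e4 : (-32 * cv d γ s t (Fin.last d) ^ 3 * zc (d+1) x (Fin.last d) y ^ 2 + 8 * cv d γ s t (Fin.last d) ^ 2) =
      (- (ww d x y : ℂ) / (2 * be γ s t ^ 3) + 1 / (2 * be γ s t ^ 2)) := by
    simp only [cv_last, ww, zc]
    push_cast
    field_simp
    ring
  have e5 : ∀ i : Fin d, ¬ (Fin.last d = i.castSucc) := fun i => (Fin.castSucc_lt_last i).ne'
  simp only [Fin.castSucc_inj, e5, if_false, add_zero, ← Finset.sum_mul, if_true, Finset.sum_add_distrib,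
    Finset.sum_ite_eq', Finset.sum_ite_eq, Finset.mem_univ, ← Finset.mul_sum, e1, e2, e3, e4]
  rw [LL]
  ring

lemma F_LL (d : ℕ) (γ : ℝ) (hγ : γ ∈ Set.Ioo 0 Real.pi) (F : En (d+1) → ℝ)
    (hFm : AEStronglyMeasurable F volume)
    (hFi : Integrable (fun y => F y * ((1 + ‖y‖) ^ (d+1))⁻¹) volume)
    (hFfund : ∀ ψ : En (d+1) → ℝ, ContDiff ℝ (⊤ : ℕ∞) ψ → HasCompactSupport ψ →
      ∫ y, F y * Lgamma d γ ψ y = ψ 0) (x : En (d+1)) {s t : ℝ} (hs : 0 < s) (ht : 0 < t) :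
    ∫ y, F y • LL d γ (rr d x y) (ww d x y) s t = HH d γ (rr d x 0) (ww d x 0) s t := by
  have h : 0 < s + t := by positivity
  have hk := kap_pos hγ
  have hc : ∀ k, Real.cos (γ / 2) / (4 * (s + t)) ≤ (cv d γ s t k).re := by
    intro k
    refine Fin.lastCases ?_ (fun i => ?_) k
    · rw [cv_last, inv_be_re]; exact inv_al_re hγ hs.le ht.le h
    · rw [cv_cast]; exact inv_al_re hγ hs.le ht.le h
  obtain ⟨C, hC⟩ := gs_dec (d+1) (Kv d γ s t) (cv d γ s t) x _ (by positivity) hc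
  have := ext_complex d γ F hFm hFi hFfund _ (gs_smooth (d+1) (Kv d γ s t) (cv d γ s t) x) C hC
  simp only [LC_gs hγ h, gs_eq] at this
  exact this

set_option maxHeartbeats 1600000 in
lemma LL_bd {d : ℕ} {γ : ℝ} (hγ : γ ∈ Set.Ioo 0 Real.pi) (x : En (d+1)) {ε R : ℝ} (hε : 0 < ε) (hR : ε ≤ R) :
    ∃ C : ℝ, ∀ s ∈ Set.Icc ε R, ∀ t ∈ Set.Icc ε R, ∀ y,
      ‖LL d γ (rr d x y) (ww d x y) s t‖ ≤ C * ((1 + ‖y‖) ^ (d+1))⁻¹ := by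
  have hk := kap_pos hγ
  set κ := Real.cos (γ / 2)
  set δ := κ / (4 * (R + R)) with hδ
  have hδp : 0 < δ := by have : 0 < R := hε.trans_le hR
                         positivity
  obtain ⟨C1, hC1, h1⟩ := exp_bound 4 (δ / 2) (by positivity)
  obtain ⟨C2, hC2, h2⟩ := gauss_le (d+1) (d+1) x (δ / 2) (by positivity)
  set M := 1 + 1 / (κ * ε) with hM
  have hM1 : 1 ≤ M := by rw [hM]; have : 0 < 1 / (κ * ε) := by positivity
                         linarith
  set D : ℝ := d + 1 with hD
  have hdd : (0:ℝ) ≤ d := Nat.cast_nonneg d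
  have hD1 : 1 ≤ D := by rw [hD]; linarith
  set A := K0 d * κ ^ (-((d + 1 : ℝ) / 2)) * ε ^ (-((d + 1 : ℝ) / 2)) with hA
  have hAp : 0 < A := by have := K0_pos d; positivity
  refine ⟨6 * D ^ 2 * M ^ 4 * A * C1 * C2, fun s hs t ht y => ?_⟩
  have hs0 : 0 < s := hε.trans_le hs.1
  have ht0 : 0 < t := hε.trans_le ht.1
  have hst : 0 < s + t := by positivity
  have hr := rr_nonneg d x y
  have hw := ww_nonneg d x y
  have hrw := rr_ww d x y
  set r := rr d x y
  set w := ww d x y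
  set z := ‖y - x‖ with hz
  have hz0 : 0 ≤ z := norm_nonneg _
  set u := 1 + r + w with hu
  have hu1 : 1 ≤ u := by rw [hu]; linarith
  -- HH
  have hH : ‖HH d γ r w s t‖ ≤ A * Real.exp (-(δ * z ^ 2)) := by
    refine (HH_norm_le hγ hs0.le ht0.le hst hr hw).trans ?_
    rw [hA]
    have hK := K0_pos d
    gcongr (_ * ?_) * ?_
    · apply Real.rpow_le_rpow_of_nonpos hε (by linarith [hs.1]); linarith
    · apply Real.exp_le_exp.2
      rw [← hrw]
      apply neg_le_neg
      apply mul_le_mul_of_nonneg_right _ (by positivity)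
      rw [hδ]
      gcongr
      exacts [hs.2, ht.2]
  have ha : ‖(al γ s t)⁻¹‖ ≤ M := by
    rw [norm_inv]
    have h3 : κ * ε ≤ ‖al γ s t‖ := le_trans (by gcongr; linarith [hs.1]) (al_ge γ s t)
    have : ‖al γ s t‖⁻¹ ≤ 1 / (κ * ε) := by rw [one_div]; gcongr
    linarith
  have hb : ‖(be γ s t)⁻¹‖ ≤ M := by
    rw [norm_inv, be_norm, ← norm_inv]; exact ha
  have rn : ‖(r:ℂ)‖ = r := by rw [Complex.norm_real, Real.norm_of_nonneg hr]
  have wn : ‖(w:ℂ)‖ = w := by rw [Complex.norm_real, Real.norm_of_nonneg hw]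
  have dn : ‖(d:ℂ)‖ = d := by simp
  have hM0 : 0 ≤ M := by linarith
  have hMM : M ≤ M ^ 2 := by nlinarith
  have hM23 : M ^ 2 ≤ M ^ 3 := by nlinarith [sq_nonneg M]
  have hM34 : M ^ 3 ≤ M ^ 4 := by nlinarith [pow_nonneg hM0 3]
  have hP : ‖PP d γ r s t‖ ≤ D * u * M ^ 2 := by
    have e : PP d γ r s t = r * (1/4) * (al γ s t)⁻¹ ^ 2 - d * (1/2) * (al γ s t)⁻¹ := by
      rw [PP]; simp only [div_eq_mul_inv, mul_inv, inv_pow]; ring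
    rw [e]
    refine (norm_sub_le _ _).trans ?_
    rw [norm_mul, norm_mul, norm_mul, norm_mul, norm_pow, rn, dn]
    have n1 : ‖(1/4:ℂ)‖ = 1/4 := by norm_num
    have n2 : ‖(1/2:ℂ)‖ = 1/2 := by norm_num
    rw [n1, n2]
    calc _ ≤ r * (1/4) * M ^ 2 + d * (1/2) * M ^ 2 := by
          gcongr
          exact ha.trans hMM
      _ = (r * (1/4) + d * (1/2)) * M ^ 2 := by ring
      _ ≤ D * u * M ^ 2 := by
        gcongr
        rw [hD, hu]; nlinarith [mul_nonneg hdd hr, mul_nonneg hdd hw]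
  have hQ : ‖QQ γ w s t‖ ≤ D * u * M ^ 2 := by
    have e : QQ γ w s t = w * (1/4) * (be γ s t)⁻¹ ^ 2 - (1/2) * (be γ s t)⁻¹ := by
      rw [QQ]; simp only [div_eq_mul_inv, mul_inv, inv_pow]; ring
    rw [e]
    refine (norm_sub_le _ _).trans ?_
    rw [norm_mul, norm_mul, norm_mul, norm_pow, wn]
    have n1 : ‖(1/4:ℂ)‖ = 1/4 := by norm_num
    have n2 : ‖(1/2:ℂ)‖ = 1/2 := by norm_num
    rw [n1, n2]
    calc _ ≤ w * (1/4) * M ^ 2 + (1/2) * M ^ 2 := by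
          gcongr
          exact hb.trans hMM
      _ = (w * (1/4) + (1/2)) * M ^ 2 := by ring
      _ ≤ D * u * M ^ 2 := by
        gcongr
        rw [hD, hu]; nlinarith [mul_nonneg hdd hr, mul_nonneg hdd hw]
  have hT1 : ‖(- (r:ℂ) / (2 * al γ s t ^ 3) + d / (2 * al γ s t ^ 2))‖ ≤ D * u * M ^ 4 := by
    have e : (- (r:ℂ) / (2 * al γ s t ^ 3) + d / (2 * al γ s t ^ 2)) =
       d * (1/2) * (al γ s t)⁻¹ ^ 2 - r * (1/2) * (al γ s t)⁻¹ ^ 3 := by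
      simp only [div_eq_mul_inv, mul_inv, inv_pow]; ring
    rw [e]
    refine (norm_sub_le _ _).trans ?_
    rw [norm_mul, norm_mul, norm_mul, norm_mul, norm_pow, norm_pow, rn, dn]
    have n2 : ‖(1/2:ℂ)‖ = 1/2 := by norm_num
    rw [n2]
    calc _ ≤ d * (1/2) * M ^ 2 + r * (1/2) * M ^ 3 := by gcongr
      _ ≤ d * (1/2) * M ^ 4 + r * (1/2) * M ^ 4 := by gcongr <;> linarith
      _ = (d * (1/2) + r * (1/2)) * M ^ 4 := by ring
      _ ≤ D * u * M ^ 4 := by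
        gcongr
        rw [hD, hu]; nlinarith [mul_nonneg hdd hr, mul_nonneg hdd hw]
  have hT2 : ‖(- (w:ℂ) / (2 * be γ s t ^ 3) + 1 / (2 * be γ s t ^ 2))‖ ≤ D * u * M ^ 4 := by
    have e : (- (w:ℂ) / (2 * be γ s t ^ 3) + 1 / (2 * be γ s t ^ 2)) =
       (1/2) * (be γ s t)⁻¹ ^ 2 - w * (1/2) * (be γ s t)⁻¹ ^ 3 := by
      simp only [div_eq_mul_inv, mul_inv, inv_pow]; ring
    rw [e]
    refine (norm_sub_le _ _).trans ?_
    rw [norm_mul, norm_mul, norm_mul, norm_pow, norm_pow, wn]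
    have n2 : ‖(1/2:ℂ)‖ = 1/2 := by norm_num
    rw [n2]
    calc _ ≤ (1/2) * M ^ 2 + w * (1/2) * M ^ 3 := by gcongr
      _ ≤ (1/2) * M ^ 4 + w * (1/2) * M ^ 4 := by gcongr <;> linarith
      _ = ((1/2) + w * (1/2)) * M ^ 4 := by ring
      _ ≤ D * u * M ^ 4 := by
        gcongr
        rw [hD, hu]; nlinarith [mul_nonneg hdd hr, mul_nonneg hdd hw]
  have hS : ‖PP d γ r s t ^ 2 + 2 * Real.cos γ * PP d γ r s t * QQ γ w s t + QQ γ w s t ^ 2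
    + (- r / (2 * al γ s t ^ 3) + d / (2 * al γ s t ^ 2))
    + (- w / (2 * be γ s t ^ 3) + 1 / (2 * be γ s t ^ 2))‖ ≤ 6 * (D * u) ^ 2 * M ^ 4 := by
    have hc : ‖(2 * Real.cos γ : ℂ)‖ ≤ 2 := by
      rw [norm_mul, Complex.norm_real, Real.norm_eq_abs]
      have := Real.abs_cos_le_one γ
      norm_num; linarith
    have hDu : D * u ≤ (D * u) ^ 2 := by nlinarith [one_le_mul_of_one_le_of_one_le hD1 hu1]
    refine (norm_add_le _ _).trans ?_
    refine (add_le_add ((norm_add_le _ _).trans (add_le_add (norm_add₃_le.trans le_rfl) le_rfl)) le_rfl).trans ?_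
    rw [norm_pow, norm_pow, norm_mul, norm_mul _ (PP d γ r s t)]
    calc _ ≤ (D * u * M ^ 2) ^ 2 + 2 * (D * u * M ^ 2) * (D * u * M ^ 2) + (D * u * M ^ 2) ^ 2
            + (D * u) ^ 2 * M ^ 4 + (D * u) ^ 2 * M ^ 4 := by
          gcongr
          · exact hT1.trans (by gcongr)
          · exact hT2.trans (by gcongr)
      _ = _ := by ring
  rw [LL, norm_mul]
  have hu2 : u ^ 2 ≤ C1 * Real.exp (δ / 2 * z ^ 2) := by
    refine le_trans ?_ (h1 z hz0)
    rw [hu, add_assoc, hrw, show (1 + z) ^ 4 = ((1 + z) ^ 2) ^ 2 by ring]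
    gcongr
    nlinarith
  calc _ ≤ (6 * (D * u) ^ 2 * M ^ 4) * (A * Real.exp (-(δ * z ^ 2))) := by gcongr
    _ = 6 * D ^ 2 * M ^ 4 * A * u ^ 2 * Real.exp (-(δ * z ^ 2)) := by ring
    _ ≤ 6 * D ^ 2 * M ^ 4 * A * (C1 * Real.exp (δ / 2 * z ^ 2)) * Real.exp (-(δ * z ^ 2)) := by gcongr
    _ = 6 * D ^ 2 * M ^ 4 * A * C1 * Real.exp (-(δ / 2 * z ^ 2)) := by
      rw [show -(δ / 2 * z ^ 2) = δ / 2 * z ^ 2 + -(δ * z ^ 2) by ring, Real.exp_add]; ring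
    _ ≤ 6 * D ^ 2 * M ^ 4 * A * C1 * (C2 * ((1 + ‖y‖) ^ (d+1))⁻¹) := by
      gcongr; exact h2 y
    _ = _ := by ring

lemma HH_meas (d : ℕ) (γ : ℝ) : Measurable (fun p : (ℝ × ℝ) × (ℝ × ℝ) => HH d γ p.1.1 p.1.2 p.2.1 p.2.2) := by
  unfold HH Ph al be; fun_prop

lemma LL_meas (d : ℕ) (γ : ℝ) : Measurable (fun p : (ℝ × ℝ) × (ℝ × ℝ) => LL d γ p.1.1 p.1.2 p.2.1 p.2.2) := by
  have := HH_meas d γ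
  unfold LL
  refine Measurable.mul ?_ this
  unfold PP QQ al be; fun_prop

lemma gaussFTC {d : ℕ} {γ : ℝ} (hγ : γ ∈ Set.Ioo 0 Real.pi) (x y : En (d+1)) {ε R : ℝ} (hε : 0 < ε) (hR : ε ≤ R) :
    ∫ s in Set.Ioc ε R, ∫ t in Set.Ioc ε R, LL d γ (rr d x y) (ww d x y) s t =
    HH d γ (rr d x y) (ww d x y) R R - HH d γ (rr d x y) (ww d x y) ε R
     - (HH d γ (rr d x y) (ww d x y) R ε - HH d γ (rr d x y) (ww d x y) ε ε) := by
  obtain ⟨C, hC⟩ := LL_bd hγ x hε hR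
  set r := rr d x y
  set w := ww d x y
  have hpos : ∀ {a b : ℝ}, a ∈ Set.Icc ε R → b ∈ Set.Icc ε R → 0 < a + b := fun ha hb => by
    linarith [ha.1, hb.1]
  have hεm : ε ∈ Set.Icc ε R := ⟨le_rfl, hR⟩
  have hRm : R ∈ Set.Icc ε R := ⟨hR, le_rfl⟩
  set DD : ℝ → ℝ → ℂ := fun s t => (omb γ * PP d γ r s t + om γ * QQ γ w s t) * HH d γ r w s t with hDD
  have i1 : ∀ s ∈ Set.Ioc ε R, ∫ t in Set.Ioc ε R, LL d γ r w s t = DD s R - DD s ε := by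
    intro s hs
    have hs' : s ∈ Set.Icc ε R := ⟨hs.1.le, hs.2⟩
    rw [← intervalIntegral.integral_of_le hR]
    apply intervalIntegral.integral_eq_sub_of_hasDerivAt
    · intro t ht
      rw [Set.uIcc_of_le hR] at ht
      exact HH_dst hγ (hpos hs' ht)
    · rw [intervalIntegrable_iff_integrableOn_Ioc_of_le hR]
      apply Measure.integrableOn_of_bounded (M := C * ((1 + ‖y‖) ^ (d+1))⁻¹) (by simp)
      · exact ((LL_meas d γ).comp (f := fun t => ((r,w),(s,t))) (by fun_prop)).aestronglyMeasurable
      · filter_upwards [ae_restrict_mem measurableSet_Ioc] with t ht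
        exact hC s hs' t ⟨ht.1.le, ht.2⟩ y
  rw [setIntegral_congr_fun measurableSet_Ioc i1]
  have ci : ∀ t ∈ Set.Icc ε R, IntervalIntegrable (fun s => DD s t) volume ε R := by
    intro t ht
    apply ContinuousOn.intervalIntegrable
    rw [Set.uIcc_of_le hR]
    intro s hs
    apply ContinuousAt.continuousWithinAt
    have ha := al_ne hγ (hpos hs ht)
    have hb := be_ne hγ (hpos hs ht)
    have ca := (al_ds γ s t).continuousAt
    have cb := (be_ds γ s t).continuousAt
    have cH := (HH_ds (d := d) (r := r) (w := w) hγ (hpos hs ht)).continuousAt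
    rw [hDD]
    refine ContinuousAt.mul ?_ cH
    unfold PP QQ
    refine ContinuousAt.add (continuousAt_const.mul (ContinuousAt.sub ?_ ?_)) (continuousAt_const.mul (ContinuousAt.sub ?_ ?_))
    · exact continuousAt_const.div (continuousAt_const.mul (ca.pow 2)) (by simpa using ha)
    · exact continuousAt_const.div (continuousAt_const.mul ca) (by simpa using ha)
    · exact continuousAt_const.div (continuousAt_const.mul (cb.pow 2)) (by simpa using hb)
    · exact continuousAt_const.div (continuousAt_const.mul cb) (by simpa using hb)
  rw [← intervalIntegral.integral_of_le hR, intervalIntegral.integral_sub (ci R hRm) (ci ε hεm)]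
  congr 1
  · apply intervalIntegral.integral_eq_sub_of_hasDerivAt (f := fun s => HH d γ r w s R) _ (ci R hRm)
    intro s hs
    rw [Set.uIcc_of_le hR] at hs
    exact HH_ds hγ (hpos hs hRm)
  · apply intervalIntegral.integral_eq_sub_of_hasDerivAt (f := fun s => HH d γ r w s ε) _ (ci ε hεm)
    intro s hs
    rw [Set.uIcc_of_le hR] at hs
    exact HH_ds hγ (hpos hs hεm)

lemma main_id (d : ℕ) (γ : ℝ) (hγ : γ ∈ Set.Ioo 0 Real.pi) (F : En (d+1) → ℝ)
    (hFm : AEStronglyMeasurable F volume)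
    (hFi : Integrable (fun y => F y * ((1 + ‖y‖) ^ (d+1))⁻¹) volume)
    (hFfund : ∀ ψ : En (d+1) → ℝ, ContDiff ℝ (⊤ : ℕ∞) ψ → HasCompactSupport ψ →
      ∫ y, F y * Lgamma d γ ψ y = ψ 0) (x : En (d+1)) {ε R : ℝ} (hε : 0 < ε) (hR : ε ≤ R) :
    ∫ y, F y • (HH d γ (rr d x y) (ww d x y) R R - HH d γ (rr d x y) (ww d x y) ε R
     - (HH d γ (rr d x y) (ww d x y) R ε - HH d γ (rr d x y) (ww d x y) ε ε)) =
    ∫ p in Set.Ioc ε R ×ˢ Set.Ioc ε R, HH d γ (rr d x 0) (ww d x 0) p.1 p.2 := by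
  obtain ⟨C, hC⟩ := LL_bd hγ x hε hR
  set I := Set.Ioc ε R with hI
  have hIc : ∀ {s}, s ∈ I → s ∈ Set.Icc ε R := fun h => ⟨h.1.le, h.2⟩
  have hm : Measurable (fun q : En (d+1) × (ℝ × ℝ) => LL d γ (rr d x q.1) (ww d x q.1) q.2.1 q.2.2) := by
    have h1 := (rr_cont d x).measurable
    have h2 := (ww_cont d x).measurable
    exact (LL_meas d γ).comp (f := fun q : En (d+1) × (ℝ × ℝ) => ((rr d x q.1, ww d x q.1), (q.2.1, q.2.2))) (by fun_prop)
  have hImeas : MeasurableSet (I ×ˢ I) := measurableSet_Ioc.prod measurableSet_Ioc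
  have hfin : IsFiniteMeasure ((volume : Measure (ℝ × ℝ)).restrict (I ×ˢ I)) := by
    constructor
    rw [Measure.restrict_apply_univ, Measure.volume_eq_prod, Measure.prod_prod]
    simp [hI, ENNReal.mul_lt_top]
  have hint : Integrable (Function.uncurry fun (y : En (d+1)) (p : ℝ × ℝ) => F y • LL d γ (rr d x y) (ww d x y) p.1 p.2)
      (volume.prod (volume.restrict (I ×ˢ I))) := by
    have hb : Integrable (fun q : En (d+1) × (ℝ × ℝ) => (C * |F q.1 * ((1 + ‖q.1‖) ^ (d+1))⁻¹|) * 1)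
        (volume.prod (volume.restrict (I ×ˢ I))) := 
      Integrable.mul_prod (f := fun y : En (d+1) => C * |F y * ((1 + ‖y‖) ^ (d+1))⁻¹|) (g := fun _ => (1:ℝ))
        (hFi.abs.const_mul C) (integrable_const _)
    refine hb.mono' ?_ ?_
    · exact (hFm.comp_fst).smul hm.aestronglyMeasurable
    · have h1 : ∀ᵐ q ∂((volume : Measure (En (d+1))).prod (volume.restrict (I ×ˢ I))), q.2 ∈ I ×ˢ I := by
        have := ae_restrict_mem (μ := (volume : Measure (ℝ × ℝ))) hImeas
        exact Measure.quasiMeasurePreserving_snd.ae this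
      filter_upwards [h1] with q hq
      simp only [Function.uncurry]
      rw [norm_smul, abs_mul, Real.norm_eq_abs, mul_one, abs_of_nonneg (a := ((1 + ‖q.1‖) ^ (d+1))⁻¹) (by positivity)]
      calc _ ≤ |F q.1| * (C * ((1 + ‖q.1‖) ^ (d+1))⁻¹) := by
            gcongr; exact hC _ (hIc hq.1) _ (hIc hq.2) _
        _ = _ := by ring
  have sw := integral_integral_swap hint
  have r1 : ∫ p in I ×ˢ I, ∫ y, F y • LL d γ (rr d x y) (ww d x y) p.1 p.2 =
      ∫ p in I ×ˢ I, HH d γ (rr d x 0) (ww d x 0) p.1 p.2 := by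
    apply setIntegral_congr_fun hImeas
    intro p hp
    exact F_LL d γ hγ F hFm hFi hFfund x (hε.trans hp.1.1) (hε.trans hp.2.1)
  rw [← r1, ← sw]
  congr 1
  ext y
  rw [integral_smul, ← gaussFTC hγ x y hε hR]
  congr 1
  rw [Measure.volume_eq_prod, setIntegral_prod]
  rw [← Measure.volume_eq_prod]
  apply Measure.integrableOn_of_bounded (M := C * ((1 + ‖y‖) ^ (d+1))⁻¹)
  · have := hfin.1
    rw [Measure.restrict_apply_univ] at this
    exact this.ne
  · exact (hm.comp (f := fun p : ℝ × ℝ => (y, p)) (by fun_prop)).aestronglyMeasurable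
  · filter_upwards [ae_restrict_mem hImeas] with p hp
    exact hC _ (hIc hp.1) _ (hIc hp.2) _




lemma HH_sqrt_bd {d : ℕ} {γ : ℝ} (hγ : γ ∈ Set.Ioo 0 Real.pi) : ∃ C : ℝ, 0 < C ∧ ∀ s t r w : ℝ,
    0 ≤ s → 0 ≤ t → 0 < s + t → 0 ≤ r → 0 ≤ w →
    ‖HH d γ r w s t‖ ≤ C * ((√(s + t) + √(r + w)) ^ (d+1))⁻¹ := by
  have hk := kap_pos hγ
  have hK := K0_pos d
  obtain ⟨C1, hC1, h1⟩ := exp_bound (d+1) (Real.cos (γ / 2) / 4) (by positivity)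
  refine ⟨K0 d * Real.cos (γ / 2) ^ (-((d + 1 : ℝ) / 2)) * C1, by positivity, fun s t r w hs ht hst hr hw => ?_⟩
  refine (HH_norm_le hγ hs ht hst hr hw).trans ?_
  have hq : 0 < √(s + t) := Real.sqrt_pos.2 hst
  have h2 := h1 (√(r + w) / √(s + t)) (by positivity)
  rw [div_pow, Real.sq_sqrt (by positivity), Real.sq_sqrt (by positivity)] at h2
  have e1 : (s + t) ^ (-((d + 1 : ℝ) / 2)) = (√(s + t) ^ (d + 1))⁻¹ := by
    rw [Real.rpow_neg hst.le, Real.sqrt_eq_rpow, ← Real.rpow_natCast, ← Real.rpow_mul hst.le]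
    congr 2; push_cast; ring
  have e2 : √(s + t) + √(r + w) = √(s + t) * (1 + √(r + w) / √(s + t)) := by field_simp
  rw [e1, e2, mul_pow, mul_inv, mul_assoc, mul_assoc (_ * _) C1]
  refine mul_le_mul_of_nonneg_left ?_ (by positivity)
  rw [mul_left_comm]
  refine mul_le_mul_of_nonneg_left ?_ (by positivity)
  rw [Real.exp_neg, ← div_eq_mul_inv, le_div_iff₀ (by positivity), inv_mul_le_iff₀ (by positivity), mul_comm]
  refine h2.trans (le_of_eq ?_)
  congr 2
  field_simp

lemma HH_far_bd {d : ℕ} {γ : ℝ} (hγ : γ ∈ Set.Ioo 0 Real.pi) (x : En (d+1)) : ∃ C : ℝ, 0 < C ∧ ∀ s t : ℝ,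
    0 ≤ s → 0 ≤ t → 1 ≤ s + t → ∀ y,
    ‖HH d γ (rr d x y) (ww d x y) s t‖ ≤ C * ((1 + ‖y‖) ^ (d+1))⁻¹ := by
  obtain ⟨C, hC, h⟩ := HH_sqrt_bd (d := d) hγ
  refine ⟨C * (1 + ‖x‖) ^ (d+1), by positivity, fun s t hs ht hst y => ?_⟩
  refine (h s t _ _ hs ht (by linarith) (rr_nonneg d x y) (ww_nonneg d x y)).trans ?_
  rw [rr_ww, Real.sqrt_sq (norm_nonneg _), mul_assoc]
  gcongr
  rw [inv_le_iff_one_le_mul₀ (by positivity), mul_comm _ (((1 + ‖y‖) ^ (d+1))⁻¹), mul_assoc, inv_mul_eq_div,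
    one_le_div (by positivity)]
  refine (wt_shift (d+1) x y (d+1)).trans ?_
  gcongr
  rw [← Real.sqrt_one]; gcongr

lemma HH_meas_y (d : ℕ) (γ : ℝ) (x : En (d+1)) (s t : ℝ) :
    Measurable (fun y => HH d γ (rr d x y) (ww d x y) s t) := by
  have h1 := (rr_cont d x).measurable
  have h2 := (ww_cont d x).measurable
  exact (HH_meas d γ).comp (f := fun y => ((rr d x y, ww d x y), (s, t))) (by fun_prop)

lemma HH_int {d : ℕ} {γ : ℝ} (hγ : γ ∈ Set.Ioo 0 Real.pi) {F : En (d+1) → ℝ}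
    (hFm : AEStronglyMeasurable F volume)
    (hFi : Integrable (fun y => F y * ((1 + ‖y‖) ^ (d+1))⁻¹) volume) (x : En (d+1)) {s t : ℝ}
    (hs : 0 < s) (ht : 0 < t) : Integrable (fun y => F y • HH d γ (rr d x y) (ww d x y) s t) := by
  have hk := kap_pos hγ
  have hK := K0_pos d
  obtain ⟨C, hC, h⟩ := gauss_le (d+1) (d+1) x (Real.cos (γ / 2) / (4 * (s + t))) (by positivity)
  refine F_mul_int hFm hFi _ (HH_meas_y d γ x s t).aestronglyMeasurable
    (K0 d * Real.cos (γ / 2) ^ (-((d + 1 : ℝ) / 2)) * (s + t) ^ (-((d + 1 : ℝ) / 2)) * C) fun y => ?_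
  refine (HH_norm_le hγ hs.le ht.le (by positivity) (rr_nonneg d x y) (ww_nonneg d x y)).trans ?_
  rw [rr_ww, mul_assoc _ C]
  gcongr
  exact h y

open Filter Topology in
lemma far_lim {d : ℕ} {γ : ℝ} (hγ : γ ∈ Set.Ioo 0 Real.pi) {F : En (d+1) → ℝ}
    (hFm : AEStronglyMeasurable F volume)
    (hFi : Integrable (fun y => F y * ((1 + ‖y‖) ^ (d+1))⁻¹) volume) (x : En (d+1)) (a b : ℝ → ℝ)
    (ha : ∀ᶠ c in atTop, 0 ≤ a c) (hb : ∀ᶠ c in atTop, 0 ≤ b c) (hab : Tendsto (fun c => a c + b c) atTop atTop) :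
    Tendsto (fun c => ∫ y, F y • HH d γ (rr d x y) (ww d x y) (a c) (b c)) atTop (𝓝 0) := by
  obtain ⟨C, hC, h⟩ := HH_far_bd (d := d) hγ x
  have hk := kap_pos hγ
  have hK := K0_pos d
  have : Tendsto (fun c => ∫ y, F y • HH d γ (rr d x y) (ww d x y) (a c) (b c)) atTop
      (𝓝 (∫ y : En (d+1), (0:ℂ))) := by
    apply tendsto_integral_filter_of_dominated_convergence (fun y => C * |F y * ((1 + ‖y‖) ^ (d+1))⁻¹|)
    · exact Eventually.of_forall fun c => hFm.smul (HH_meas_y d γ x _ _).aestronglyMeasurable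
    · filter_upwards [ha, hb, hab.eventually_ge_atTop 1] with c h1 h2 h3
      refine Eventually.of_forall fun y => ?_
      rw [norm_smul, abs_mul, Real.norm_eq_abs, abs_of_nonneg (a := ((1 + ‖y‖) ^ (d+1))⁻¹) (by positivity)]
      calc _ ≤ |F y| * (C * ((1 + ‖y‖) ^ (d+1))⁻¹) := by
            gcongr; exact h _ _ h1 h2 h3 y
        _ = _ := by ring
    · exact hFi.abs.const_mul C
    · refine Eventually.of_forall fun y => ?_
      rw [← smul_zero (F y)]
      refine Tendsto.const_smul ?_ _
      have h0 : Tendsto (fun c => (K0 d * Real.cos (γ / 2) ^ (-((d + 1 : ℝ) / 2))) * (a c + b c) ^ (-((d + 1 : ℝ) / 2)))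
          atTop (𝓝 0) := by
        rw [← mul_zero (K0 d * Real.cos (γ / 2) ^ (-((d + 1 : ℝ) / 2)))]
        exact ((tendsto_rpow_neg_atTop (by positivity)).comp hab).const_mul _
      refine squeeze_zero_norm' ?_ h0
      filter_upwards [ha, hb, hab.eventually_ge_atTop 1] with c h1 h2 h3
      refine (HH_norm_le hγ h1 h2 (by linarith) (rr_nonneg d x y) (ww_nonneg d x y)).trans ?_
      apply mul_le_of_le_one_right (by positivity)
      rw [Real.exp_le_one_iff, neg_nonpos]
      have := rr_nonneg d x y
      have := ww_nonneg d x y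
      have : 0 < a c + b c := by linarith
      positivity
  simpa using this

lemma HH_diag {d : ℕ} {γ : ℝ} (hγ : γ ∈ Set.Ioo 0 Real.pi) (r w c : ℝ) (hc : 0 < c) :
    HH d γ r w (1 / (8 * Real.cos (γ / 2) * c ^ 2)) (1 / (8 * Real.cos (γ / 2) * c ^ 2)) =
     ((Real.pi ^ (-((d + 1 : ℝ) / 2)) * c ^ (d+1) * Real.exp (-(c ^ 2 * (r + w))) : ℝ) : ℂ) := by
  have hk := kap_pos hγ
  set κ := Real.cos (γ / 2) with hκ
  set ε := 1 / (8 * κ * c ^ 2) with hε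
  have hoo : om γ + omb γ = 2 * (κ : ℂ) := by
    rw [omb_conj, Complex.add_conj, om_re, ← hκ]; push_cast; ring
  have ha : al γ ε ε = ((1 / (4 * c ^ 2) : ℝ) : ℂ) := by
    have : al γ ε ε = ε * (om γ + omb γ) := by rw [al]; ring
    rw [this, hoo, hε]
    have : (κ : ℂ) ≠ 0 := by exact_mod_cast hk.ne'
    push_cast
    field_simp
    norm_num
  have hb : be γ ε ε = ((1 / (4 * c ^ 2) : ℝ) : ℂ) := by
    have : be γ ε ε = ε * (om γ + omb γ) := by rw [be]; ring
    rw [this, hoo, hε]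
    have : (κ : ℂ) ≠ 0 := by exact_mod_cast hk.ne'
    push_cast
    field_simp
    norm_num
  have hcc : (c : ℂ) ≠ 0 := by exact_mod_cast hc.ne'
  set τ : ℝ := 1 / (4 * c ^ 2) with hτ
  have hτp : 0 < τ := by positivity
  have e : Ph d γ r w ε ε = ((-((d + 1 : ℝ) / 2) * Real.log τ + -(c ^ 2 * (r + w)) : ℝ) : ℂ) := by
    rw [Ph, ha, hb, ← Complex.ofReal_log hτp.le]
    have : (1 : ℂ) / (4 * (τ : ℂ)) = c ^ 2 := by
      rw [hτ]; push_cast; field_simp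
    rw [this]
    push_cast
    ring
  rw [HH, e, ← Complex.ofReal_exp, ← Complex.ofReal_mul]
  congr 1
  rw [Real.exp_add, ← mul_assoc, mul_comm _ (Real.log τ), ← Real.rpow_def_of_pos hτp, K0,
    ← Real.mul_rpow (by positivity) hτp.le]
  have : 4 * Real.pi * τ = Real.pi * (c ^ 2)⁻¹ := by rw [hτ]; field_simp
  rw [this, Real.mul_rpow Real.pi_pos.le (by positivity), Real.inv_rpow (by positivity), Real.rpow_neg (sq_nonneg c), inv_inv]
  congr 2
  rw [← Real.rpow_natCast c 2, ← Real.rpow_mul hc.le, ← Real.rpow_natCast]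
  congr 1; push_cast; ring

open Filter Topology in
lemma peak_lim {d : ℕ} {γ : ℝ} (hγ : γ ∈ Set.Ioo 0 Real.pi) {F : En (d+1) → ℝ}
    (hFm : AEStronglyMeasurable F volume)
    (hFi : Integrable (fun y => F y * ((1 + ‖y‖) ^ (d+1))⁻¹) volume) (x : En (d+1)) (hx : ContinuousAt F x) :
    Tendsto (fun c : ℝ => ∫ y, F y • HH d γ (rr d x y) (ww d x y) (1 / (8 * Real.cos (γ / 2) * (c ^ 2 + 1))) 
      (1 / (8 * Real.cos (γ / 2) * (c ^ 2 + 1)))) atTop (𝓝 (F x : ℂ)) := by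
  set φ : En (d+1) → ℝ := fun v => Real.pi ^ (-((d + 1 : ℝ) / 2)) * Real.exp (-1 * ‖v‖ ^ 2) with hφ
  have hfr : Module.finrank ℝ (En (d+1)) = d + 1 := by simp
  obtain ⟨C, hC, h⟩ := gauss_le (d+1) (d+1) x 1 one_pos
  have hg : Integrable (fun y => F y • Real.exp (-(1 * ‖y - x‖ ^ 2))) :=
    F_mul_int hFm hFi _ (by fun_prop) C fun y => by
      rw [Real.norm_of_nonneg (Real.exp_pos _).le]; exact h y
  have h1 : ∫ v, φ v = 1 := by
    rw [hφ, integral_const_mul, GaussianFourier.integral_rexp_neg_mul_sq_norm one_pos, hfr, div_one,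
      ← Real.rpow_add Real.pi_pos]
    push_cast
    rw [neg_add_cancel, Real.rpow_zero]
  have h2 : Tendsto (fun v => ‖v‖ ^ Module.finrank ℝ (En (d+1)) * φ v) (Bornology.cobounded _) (𝓝 0) := by
    obtain ⟨C1, hC1, h3⟩ := exp_bound (d+2) 1 one_pos
    have ht : Tendsto (fun v : En (d+1) => Real.pi ^ (-((d + 1 : ℝ) / 2)) * C1 * (1 + ‖v‖)⁻¹) (Bornology.cobounded _) (𝓝 0) := by
      rw [← mul_zero (Real.pi ^ (-((d + 1 : ℝ) / 2)) * C1)]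
      apply Tendsto.const_mul
      exact tendsto_inv_atTop_zero.comp (tendsto_atTop_add_const_left _ _ tendsto_norm_cobounded_atTop)
    refine squeeze_zero (fun v => by positivity) (fun v => ?_) ht
    rw [hfr, hφ]
    simp only
    rw [mul_left_comm, mul_assoc]
    refine mul_le_mul_of_nonneg_left ?_ (by positivity)
    have h4 := h3 ‖v‖ (norm_nonneg v)
    rw [neg_mul, Real.exp_neg, ← div_eq_mul_inv, ← div_eq_mul_inv, div_le_div_iff₀ (by positivity) (by positivity)]
    refine le_trans ?_ h4
    rw [pow_succ (1 + ‖v‖)]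
    gcongr
    linarith
  have key := tendsto_integral_comp_smul_smul_of_integrable' (μ := volume) (φ := φ) (fun v => by positivity) h1 h2 
    (x₀ := x) hg (hx.smul (by fun_prop))
  simp only [sub_self, norm_zero, hfr] at key
  norm_num at key
  have hrat : Tendsto (fun c : ℝ => (√(c ^ 2 + 1) / c) ^ (d+1)) atTop (𝓝 1) := by
    have : Tendsto (fun c : ℝ => (√(1 + (c⁻¹) ^ 2)) ^ (d+1)) atTop (𝓝 1) := by
      have h5 : Tendsto (fun c : ℝ => (√(1 + (c⁻¹) ^ 2)) ^ (d+1)) atTop (𝓝 ((√(1 + 0 ^ 2)) ^ (d+1))) :=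
        (((tendsto_inv_atTop_zero.pow 2).const_add 1).sqrt).pow (d+1)
      simpa using h5
    refine this.congr' ?_
    filter_upwards [eventually_gt_atTop 0] with c hc
    congr 1
    rw [eq_div_iff hc.ne', ← Real.sqrt_sq hc.le, ← Real.sqrt_mul (by positivity), Real.sqrt_sq hc.le]
    congr 1; field_simp
  have key2 := (hrat.mul key)
  rw [one_mul] at key2
  have key3 := (Complex.continuous_ofReal.tendsto (F x)).comp key2
  refine key3.congr' ?_
  filter_upwards [eventually_gt_atTop 0] with c hc
  simp only [Function.comp]
  rw [← integral_const_mul, ← integral_complex_ofReal]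
  congr 1
  ext y
  have hc1 : 0 < √(c ^ 2 + 1) := Real.sqrt_pos.2 (by positivity)
  have := HH_diag (d := d) hγ (rr d x y) (ww d x y) (√(c ^ 2 + 1)) hc1
  rw [Real.sq_sqrt (by positivity), rr_ww] at this
  rw [this, Complex.real_smul, ← Complex.ofReal_mul]
  congr 1
  rw [hφ]
  simp only
  rw [norm_smul, mul_pow, Real.norm_eq_abs, sq_abs, norm_sub_rev x y,
   show -((c ^ 2 + 1) * ‖y - x‖ ^ 2) = -1 * (c ^ 2 * ‖y - x‖ ^ 2) + -‖y - x‖ ^ 2 by ring, Real.exp_add, div_pow]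
  field_simp

lemma quad_bd {d : ℕ} (hd : 5 ≤ d + 1) {γ : ℝ} (hγ : γ ∈ Set.Ioo 0 Real.pi) {r w : ℝ} (hr : 0 ≤ r) (hw : 0 ≤ w)
    (hrw : 0 < r + w) : ∃ C : ℝ, 0 < C ∧ ∀ s t : ℝ, 0 < s → 0 < t →
     ‖HH d γ r w s t‖ ≤ C * ((s + 1) ^ (-(5/4) : ℝ) * (t + 1) ^ (-(5/4) : ℝ)) ∧
     ‖HH d γ r w s t‖ ≤ C * ((s + t) ^ (-(5/4) : ℝ) * (s + 1) ^ (-(5/4) : ℝ)) := by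
  obtain ⟨C, hC, h⟩ := HH_sqrt_bd (d := d) hγ
  set m := min 1 √(r + w) with hm
  have hmp : 0 < m := lt_min one_pos (Real.sqrt_pos.2 hrw)
  refine ⟨C * (m ^ (d+1))⁻¹, by positivity, fun s t hs ht => ?_⟩
  have h1 := h s t r w hs.le ht.le (by positivity) hr hw
  have h2 : (√(s + t) + √(r + w)) ^ (d+1) ≥ m ^ (d+1) * (s + t + 1) ^ (5/2 : ℝ) := by
    have a1 : m * (√(s + t) + 1) ≤ √(s + t) + √(r + w) := by
      have := min_le_left 1 √(r + w)
      have := min_le_right 1 √(r + w)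
      have := Real.sqrt_nonneg (s + t)
      nlinarith
    have a2 : (s + t + 1) ^ (5/2 : ℝ) ≤ (√(s + t) + 1) ^ (d + 1) := by
      have a3 : s + t + 1 ≤ (√(s + t) + 1) ^ 2 := by
        have := Real.sq_sqrt (show 0 ≤ s + t by positivity)
        nlinarith [Real.sqrt_nonneg (s + t)]
      calc (s + t + 1) ^ (5/2 : ℝ) ≤ ((√(s + t) + 1) ^ 2) ^ (5/2 : ℝ) := by gcongr
        _ = (√(s + t) + 1) ^ 5 := by
          rw [← Real.rpow_natCast _ 2, ← Real.rpow_mul (by positivity), ← Real.rpow_natCast]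
          norm_num
        _ ≤ _ := by
          apply pow_le_pow_right₀ _ hd
          linarith [Real.sqrt_nonneg (s + t)]
    calc _ ≤ m ^ (d+1) * (√(s + t) + 1) ^ (d + 1) := by gcongr
      _ = (m * (√(s + t) + 1)) ^ (d+1) := by rw [mul_pow]
      _ ≤ _ := by gcongr
  have h3 : ‖HH d γ r w s t‖ ≤ C * (m ^ (d+1))⁻¹ * ((s + t + 1) ^ (5/2 : ℝ))⁻¹ := by
    refine h1.trans ?_
    rw [mul_assoc, ← mul_inv]
    gcongr
  have e1 : ∀ a b : ℝ, 0 < a → 0 < b → a * b ≤ (s + t + 1) ^ 2 →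
      ((s + t + 1) ^ (5/2 : ℝ))⁻¹ ≤ a ^ (-(5/4) : ℝ) * b ^ (-(5/4) : ℝ) := by
    intro a b ha hb hab
    rw [← Real.mul_rpow ha.le hb.le, Real.rpow_neg (by positivity)]
    gcongr
    calc (a * b) ^ (5/4 : ℝ) ≤ ((s + t + 1) ^ 2) ^ (5/4 : ℝ) := by gcongr
      _ = _ := by
        rw [← Real.rpow_natCast _ 2, ← Real.rpow_mul (by positivity)]
        norm_num
  constructor
  · refine h3.trans ?_
    gcongr
    exact e1 _ _ (by positivity) (by positivity) (by nlinarith [mul_pos hs ht])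
  · refine h3.trans ?_
    gcongr
    exact e1 _ _ (by positivity) (by positivity) (by nlinarith [mul_pos hs ht])

lemma HH_meas_p (d : ℕ) (γ r w : ℝ) : Measurable (fun p : ℝ × ℝ => HH d γ r w p.1 p.2) :=
  (HH_meas d γ).comp (f := fun p : ℝ × ℝ => ((r, w), p)) (by fun_prop)

lemma quad_int {d : ℕ} (hd : 5 ≤ d + 1) {γ : ℝ} (hγ : γ ∈ Set.Ioo 0 Real.pi) {r w : ℝ} (hr : 0 ≤ r) (hw : 0 ≤ w)
    (hrw : 0 < r + w) : IntegrableOn (fun p : ℝ × ℝ => HH d γ r w p.1 p.2) (Set.Ioi 0 ×ˢ Set.Ioi 0) := by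
  obtain ⟨C, hC, h⟩ := quad_bd hd hγ hr hw hrw
  have hi : IntegrableOn (fun s : ℝ => (s + 1) ^ (-(5/4) : ℝ)) (Set.Ioi 0) :=
    integrableOn_add_rpow_Ioi_of_lt (by norm_num) (by norm_num)
  have h2 := (Integrable.mul_prod hi hi).const_mul C
  rw [Measure.prod_restrict, ← Measure.volume_eq_prod] at h2
  refine Integrable.mono' h2 (HH_meas_p d γ r w).aestronglyMeasurable ?_
  filter_upwards [ae_restrict_mem (measurableSet_Ioi.prod measurableSet_Ioi)] with p hp
  exact (h p.1 p.2 hp.1 hp.2).1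

open Filter Topology in
lemma F_formula (d : ℕ) (hd : 5 ≤ d + 1) (γ : ℝ) (hγ : γ ∈ Set.Ioo 0 Real.pi) (F : En (d+1) → ℝ)
    (hFm : AEStronglyMeasurable F volume)
    (hFi : Integrable (fun y => F y * ((1 + ‖y‖) ^ (d+1))⁻¹) volume)
    (hFfund : ∀ ψ : En (d+1) → ℝ, ContDiff ℝ (⊤ : ℕ∞) ψ → HasCompactSupport ψ →
      ∫ y, F y * Lgamma d γ ψ y = ψ 0) (x : En (d+1)) (hx0 : x ≠ 0) (hx : ContinuousAt F x) :
    (F x : ℂ) = ∫ p in Set.Ioi (0:ℝ) ×ˢ Set.Ioi (0:ℝ), HH d γ (rr d x 0) (ww d x 0) p.1 p.2 := by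
  have hk := kap_pos hγ
  set ε : ℝ → ℝ := fun c => 1 / (8 * Real.cos (γ / 2) * (c ^ 2 + 1)) with hε
  have hεp : ∀ c, 0 < ε c := fun c => by rw [hε]; positivity
  have hε0 : Tendsto ε atTop (𝓝 0) := by
    have h1 : Tendsto (fun c : ℝ => 8 * Real.cos (γ / 2) * (c ^ 2 + 1)) atTop atTop :=
      (tendsto_atTop_add_const_right _ _ (tendsto_pow_atTop two_ne_zero)).const_mul_atTop (by positivity)
    simp only [hε, one_div]
    exact tendsto_inv_atTop_zero.comp h1
  have hεR : ∀ᶠ c in atTop, ε c ≤ c := by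
    filter_upwards [hε0.eventually_lt_const one_pos, eventually_ge_atTop 1] with c h1 h2
    linarith
  have hR0 : ∀ᶠ c : ℝ in atTop, 0 ≤ c := eventually_ge_atTop 0
  have hεn : ∀ᶠ c in atTop, 0 ≤ ε c := Eventually.of_forall fun c => (hεp c).le
  have l1 := far_lim hγ hFm hFi x (fun c => c) (fun c => c) hR0 hR0 (tendsto_id.atTop_add_atTop tendsto_id)
  have l2 := far_lim hγ hFm hFi x ε (fun c => c) hεn hR0 (hε0.add_atTop tendsto_id)
  have l3 := far_lim hγ hFm hFi x (fun c => c) ε hR0 hεn (tendsto_id.atTop_add hε0)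
  have l4 := peak_lim hγ hFm hFi x hx
  have L := (l1.sub l2).sub (l3.sub l4)
  have hcov : AECover ((volume : Measure (ℝ × ℝ)).restrict (Set.Ioi 0 ×ˢ Set.Ioi 0)) atTop
      (fun c => Set.Ioc (ε c) c ×ˢ Set.Ioc (ε c) c) := by
    constructor
    · filter_upwards [ae_restrict_mem (measurableSet_Ioi.prod measurableSet_Ioi)] with p hp
      filter_upwards [hε0.eventually_lt_const hp.1, hε0.eventually_lt_const hp.2, eventually_ge_atTop p.1,
        eventually_ge_atTop p.2] with c h1 h2 h3 h4
      exact ⟨⟨h1, h3⟩, ⟨h2, h4⟩⟩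
    · exact fun c => measurableSet_Ioc.prod measurableSet_Ioc
  have hrw : 0 < rr d x 0 + ww d x 0 := by
    rw [rr_ww, zero_sub, norm_neg]; exact pow_pos (norm_pos_iff.2 hx0) 2
  have RL := hcov.integral_tendsto_of_countably_generated (quad_int hd hγ (rr_nonneg d x 0) (ww_nonneg d x 0) hrw)
  have : (F x : ℂ) = 0 - 0 - (0 - (F x : ℂ)) := by ring
  rw [this]
  refine tendsto_nhds_unique L (RL.congr' ?_)
  filter_upwards [hεR] with c hc
  have hc0 : 0 < c := (hεp c).trans_le hc
  have I1 := HH_int (d := d) hγ hFm hFi x hc0 hc0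
  have I2 := HH_int (d := d) hγ hFm hFi x (hεp c) hc0
  have I3 := HH_int (d := d) hγ hFm hFi x hc0 (hεp c)
  have I4 := HH_int (d := d) hγ hFm hFi x (hεp c) (hεp c)
  have M := main_id d γ hγ F hFm hFi hFfund x (hεp c) hc
  rw [Measure.restrict_restrict (measurableSet_Ioc.prod measurableSet_Ioc), Set.inter_eq_self_of_subset_left, ← M]
  · have e := integral_sub (I1.sub I2) (I3.sub I4)
    simp only [Pi.sub_apply] at e
    rw [← integral_sub I1 I2, ← integral_sub I3 I4, ← e]
    simp only [smul_sub]
  · exact Set.prod_mono (fun s hs => (hεp c).trans hs.1) (fun s hs => (hεp c).trans hs.1)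




lemma gint_integrable (a δ : ℝ) (ha : 0 < a) (hδ : 0 < δ) :
    IntegrableOn (fun u : ℝ => u ^ (a - 1) * Real.exp (-(δ * u))) (Set.Ioi 0) := by
  have := integrableOn_rpow_mul_exp_neg_mul_rpow (p := 1) (s := a - 1) (b := δ) (by linarith) one_pos hδ
  simpa using this

def GG (a : ℝ) (c : ℂ) : ℂ := ∫ u in Set.Ioi (0:ℝ), ((u ^ (a - 1) : ℝ) : ℂ) * Complex.exp (-(c * u))

lemma gi_norm (a u : ℝ) (c : ℂ) (hu : 0 < u) : ‖((u ^ (a - 1) : ℝ) : ℂ) * Complex.exp (-(c * u))‖ =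
    u ^ (a - 1) * Real.exp (-(c.re * u)) := by
  rw [norm_mul, Complex.norm_real, Real.norm_of_nonneg (by positivity), Complex.norm_exp]
  simp

lemma GG_diff (a : ℝ) (ha : 0 < a) (c : ℂ) (hc : 0 < c.re) : DifferentiableAt ℂ (GG a) c := by
  have hball : ∀ z ∈ Metric.ball c (c.re / 2), c.re / 2 < z.re := by
    intro z hz
    have h1 := (Complex.abs_re_le_norm (z - c)).trans_lt (by simpa [dist_eq_norm] using hz)
    rw [Complex.sub_re] at h1
    have := (abs_lt.1 h1).1
    linarith
  have := hasDerivAt_integral_of_dominated_loc_of_deriv_le (μ := volume.restrict (Set.Ioi (0:ℝ)))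
    (F := fun (c : ℂ) (u : ℝ) => ((u ^ (a - 1) : ℝ) : ℂ) * Complex.exp (-(c * u)))
    (F' := fun (c : ℂ) (u : ℝ) => ((u ^ (a - 1) : ℝ) : ℂ) * (Complex.exp (-(c * u)) * (-(1 * u))))
    (x₀ := c) (s := Metric.ball c (c.re / 2)) (bound := fun u => u ^ (a + 1 - 1) * Real.exp (-(c.re / 2 * u)))
    (Metric.ball_mem_nhds _ (by positivity)) ?_ ?_ ?_ ?_ (gint_integrable (a+1) _ (by linarith) (by positivity)) ?_
  · exact this.2.differentiableAt
  · exact Filter.Eventually.of_forall fun z => Measurable.aestronglyMeasurable (by fun_prop)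
  · refine Integrable.mono' (gint_integrable a c.re ha hc) (Measurable.aestronglyMeasurable (by fun_prop)) ?_
    filter_upwards [ae_restrict_mem measurableSet_Ioi] with u hu
    exact (gi_norm a u c hu).le
  · exact Measurable.aestronglyMeasurable (by fun_prop)
  · filter_upwards [ae_restrict_mem measurableSet_Ioi] with u hu z hz
    have hu : 0 < u := hu
    rw [← mul_assoc, norm_mul, gi_norm a u z hu, norm_neg, one_mul, Complex.norm_real, Real.norm_of_nonneg hu.le,
      mul_right_comm, ← Real.rpow_add_one hu.ne']
    rw [show a - 1 + 1 = a + 1 - 1 by ring]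
    gcongr
    exact (hball z hz).le
  · refine Filter.Eventually.of_forall fun u z _ => ?_
    exact (((hasDerivAt_id z).mul_const (u:ℂ)).neg.cexp).const_mul _

open Filter Topology in
lemma GG_eq (a : ℝ) (ha : 0 < a) (c : ℂ) (hc : 0 < c.re) :
    GG a c = Real.Gamma a * Complex.exp (-(a * Complex.log c)) := by
  set U : Set ℂ := {z | 0 < z.re} with hU
  have hUo : IsOpen U := isOpen_lt continuous_const Complex.continuous_re
  have h1 : AnalyticOnNhd ℂ (GG a) U := DifferentiableOn.analyticOnNhd
    (fun z hz => (GG_diff a ha z hz).differentiableWithinAt) hUo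
  have h2 : AnalyticOnNhd ℂ (fun c => Real.Gamma a * Complex.exp (-(a * Complex.log c))) U := 
    DifferentiableOn.analyticOnNhd (fun z hz => by
      have : z ∈ Complex.slitPlane := Or.inl hz
      have := Complex.differentiableAt_log this
      exact DifferentiableAt.differentiableWithinAt (by fun_prop)) hUo
  have hpc : IsPreconnected U := (convex_halfSpace_re_gt 0).isPreconnected
  refine h1.eqOn_of_preconnected_of_frequently_eq h2 hpc (z₀ := 1) (by simp [hU]) ?_ hc
  have ht : Tendsto (fun n : ℕ => ((1 + 1 / ((n : ℝ) + 1) : ℝ) : ℂ)) atTop (𝓝[≠] 1) := by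
    rw [tendsto_nhdsWithin_iff]
    constructor
    · have := (tendsto_one_div_add_atTop_nhds_zero_nat (𝕜 := ℝ)).const_add 1
      have := (Complex.continuous_ofReal.tendsto _).comp this
      rw [add_zero, Complex.ofReal_one] at this
      exact this
    · refine Eventually.of_forall fun n => ?_
      have : (0:ℝ) < 1 / ((n:ℝ) + 1) := by positivity
      rw [Set.mem_compl_iff, Set.mem_singleton_iff, ← Complex.ofReal_one, Complex.ofReal_inj]
      linarith
  refine ht.frequently (Eventually.of_forall fun n => ?_).frequently
  set r : ℝ := 1 + 1 / ((n : ℝ) + 1) with hr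
  have hrp : 0 < r := by positivity
  have h3 := Real.integral_rpow_mul_exp_neg_mul_Ioi ha hrp
  have h4 : GG a r = ((∫ t in Set.Ioi (0:ℝ), t ^ (a - 1) * Real.exp (-(r * t)) : ℝ) : ℂ) := by
    rw [GG, ← integral_complex_ofReal]
    push_cast
    rfl
  rw [h4, h3, ← Complex.ofReal_log hrp.le]
  push_cast
  rw [mul_comm]
  congr 1
  rw [one_div, Real.inv_rpow hrp.le, ← Real.rpow_neg hrp.le, Real.rpow_def_of_pos hrp]
  push_cast
  congr 1; ring

lemma inv_int (a : ℝ) (ha : 0 < a) (c : ℂ) (hc : 0 < c.re) :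
    ∫ s in Set.Ioi (0:ℝ), ((s ^ (-a - 1) : ℝ) : ℂ) * Complex.exp (-(c / s)) =
     Real.Gamma a * Complex.exp (-(a * Complex.log c)) := by
  rw [← GG_eq a ha c hc, GG, ← integral_comp_rpow_Ioi _ (show (-1:ℝ) ≠ 0 by norm_num)]
  apply setIntegral_congr_fun measurableSet_Ioi
  intro u hu
  have hu : 0 < u := hu
  simp only
  rw [Complex.real_smul, ← mul_assoc, ← Complex.ofReal_mul, Real.rpow_neg_one]
  congr 3
  · rw [Real.inv_rpow hu.le, ← Real.rpow_neg hu.le, abs_neg, abs_one, one_mul, ← Real.rpow_add hu]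
    congr 1; ring
  · push_cast; rw [div_inv_eq_mul]

lemma al_scale (γ s q : ℝ) : al γ s (s * q) = s * al γ 1 q := by simp [al]; ring
lemma be_scale (γ s q : ℝ) : be γ s (s * q) = s * be γ 1 q := by simp [be]; ring

lemma HH_scale {d : ℕ} {γ : ℝ} (hγ : γ ∈ Set.Ioo 0 Real.pi) (w s q : ℝ) (hs : 0 < s) (hq : 0 ≤ q) :
    s * HH d γ 0 w s (s * q) = K0 d * Complex.exp (-((d / 2 : ℝ) : ℂ) * Complex.log (al γ 1 q)
       - (1 / 2 : ℂ) * Complex.log (be γ 1 q)) * (((s ^ (-((d - 3 : ℝ) / 2) - 1) : ℝ) : ℂ) * 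
        Complex.exp (-((w / (4 * be γ 1 q)) / s))) := by
  have h1q : 0 < 1 + q := by linarith
  have hA := al_ne hγ h1q
  have hB := be_ne hγ h1q
  have hsc : (s : ℂ) ≠ 0 := by exact_mod_cast hs.ne'
  have e1 : ((s ^ (-((d - 3 : ℝ) / 2) - 1) : ℝ) : ℂ) = s * Complex.exp (-((d + 1 : ℝ) / 2 : ℝ) * Complex.log s) := by
    rw [show (-((d - 3 : ℝ) / 2) - 1) = 1 + -((d + 1 : ℝ) / 2) by ring, Real.rpow_add hs, Real.rpow_one,
      Complex.ofReal_mul, Real.rpow_def_of_pos hs, Complex.ofReal_exp, Complex.ofReal_mul, Complex.ofReal_log hs.le]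
    push_cast
    ring_nf
  rw [HH, Ph, al_scale, be_scale, Complex.log_ofReal_mul hs hA, Complex.log_ofReal_mul hs hB, e1, Complex.ofReal_log hs.le]
  rw [show K0 d * Complex.exp (-((d / 2 : ℝ) : ℂ) * Complex.log (al γ 1 q) - (1 / 2 : ℂ) * Complex.log (be γ 1 q)) *
    (s * Complex.exp (-((d + 1 : ℝ) / 2 : ℝ) * Complex.log s) * Complex.exp (-((w / (4 * be γ 1 q)) / s))) =
    s * (K0 d * (Complex.exp (-((d / 2 : ℝ) : ℂ) * Complex.log (al γ 1 q) - (1 / 2 : ℂ) * Complex.log (be γ 1 q)) *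
    Complex.exp (-((d + 1 : ℝ) / 2 : ℝ) * Complex.log s) * Complex.exp (-((w / (4 * be γ 1 q)) / s)))) by ring,
    ← Complex.exp_add, ← Complex.exp_add]
  congr 3
  push_cast
  field_simp
  ring

lemma s_int {d : ℕ} (hd : 5 ≤ d + 1) {γ : ℝ} (hγ : γ ∈ Set.Ioo 0 Real.pi) (w q : ℝ) (hw : 0 < w) (hq : 0 ≤ q) :
    ∫ s in Set.Ioi (0:ℝ), s * HH d γ 0 w s (s * q) = 
      ((K0 d * Real.Gamma ((d - 3 : ℝ) / 2) * (w / 4) ^ (-((d - 3 : ℝ) / 2)) : ℝ) : ℂ) *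
      Complex.exp (-((d / 2 : ℝ) : ℂ) * Complex.log (al γ 1 q) + (((d - 4) / 2 : ℝ) : ℂ) * Complex.log (be γ 1 q)) := by
  have h1q : 0 < 1 + q := by linarith
  have hA := al_ne hγ h1q
  have hB := be_ne hγ h1q
  have hd' : (4:ℝ) ≤ d := by exact_mod_cast (by omega : 4 ≤ d)
  rw [setIntegral_congr_fun measurableSet_Ioi (fun s hs => HH_scale (d := d) hγ w s q hs hq), integral_const_mul]
  have hc : (w / (4 * be γ 1 q) : ℂ) = ((w / 4 : ℝ) : ℂ) * (be γ 1 q)⁻¹ := by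
    push_cast; field_simp
  have hinv : 0 < ((be γ 1 q)⁻¹).re := by
    rw [Complex.inv_re]
    exact div_pos (be_re_pos hγ h1q) (Complex.normSq_pos.2 hB)
  rw [inv_int _ (by linarith) _ (by rw [hc, Complex.re_ofReal_mul]; positivity), hc,
    Complex.log_ofReal_mul (by positivity) (inv_ne_zero hB), Complex.log_inv _ (Complex.slitPlane_arg_ne_pi (be_slit hγ h1q)),
    Real.rpow_def_of_pos (by positivity)]
  push_cast
  rw [show ∀ a b c e : ℂ, a * b * (c * e) = a * c * (b * e) by intros; ring, ← Complex.exp_add, 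
    mul_assoc _ (Complex.exp _) (Complex.exp _), ← Complex.exp_add]
  congr 2
  ring

lemma log_om {γ : ℝ} (hγ : γ ∈ Set.Ioo 0 Real.pi) : Complex.log (om γ) = (γ / 2 : ℝ) * Complex.I := by
  rw [om, Complex.log_exp] <;> simp <;> linarith [hγ.1, hγ.2]
lemma log_omb {γ : ℝ} (hγ : γ ∈ Set.Ioo 0 Real.pi) : Complex.log (omb γ) = -((γ / 2 : ℝ) * Complex.I) := by
  rw [omb, Complex.log_exp] <;> simp <;> linarith [hγ.1, hγ.2]

open Filter Topology in
lemma q_int {d : ℕ} (hd : 5 ≤ d + 1) {γ : ℝ} (hγ : γ ∈ Set.Ioo 0 Real.pi) :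
    ∫ q in Set.Ioi (0:ℝ), 
      Complex.exp (-((d / 2 : ℝ) : ℂ) * Complex.log (al γ 1 q) + (((d - 4) / 2 : ℝ) : ℂ) * Complex.log (be γ 1 q))
     = ((Real.sin ((d - 2 : ℝ) / 2 * γ) / ((d - 2 : ℝ) / 2 * Real.sin γ) : ℝ) : ℂ) := by
  have hk := kap_pos hγ
  have hd' : (4:ℝ) ≤ d := by exact_mod_cast (by omega : 4 ≤ d)
  set b : ℝ := (d - 2 : ℝ) / 2 with hb
  have hbp : 0 < b := by rw [hb]; linarith
  set f : ℝ → ℂ := fun q => Complex.exp (-((d / 2 : ℝ) : ℂ) * Complex.log (al γ 1 q) + (((d - 4) / 2 : ℝ) : ℂ) * Complex.log (be γ 1 q)) with hf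
  set E : ℝ → ℂ := fun q => Complex.exp (b * (Complex.log (be γ 1 q) - Complex.log (al γ 1 q))) with hE
  have hderiv : ∀ q ∈ Set.Ici (0:ℝ), HasDerivAt E ((b * (omb γ ^ 2 - om γ ^ 2)) * f q) q := by
    intro q hq
    have h1q : 0 < 1 + q := by have : 0 ≤ q := hq
                               linarith
    have hA := al_ne hγ h1q
    have hB := be_ne hγ h1q
    have h1 := ((((be_dt γ 1 q).clog_real (be_slit hγ h1q)).sub ((al_dt γ 1 q).clog_real (al_slit hγ h1q))).const_mul (b:ℂ)).cexp
    convert! h1 using 1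
    have e1 : f q = (be γ 1 q)⁻¹ * (al γ 1 q)⁻¹ * Complex.exp (b * (Complex.log (be γ 1 q) - Complex.log (al γ 1 q))) := by
      have l1 : (be γ 1 q)⁻¹ = Complex.exp (- Complex.log (be γ 1 q)) := by rw [Complex.exp_neg, Complex.exp_log hB]
      have l2 : (al γ 1 q)⁻¹ = Complex.exp (- Complex.log (al γ 1 q)) := by rw [Complex.exp_neg, Complex.exp_log hA]
      rw [l1, l2, ← Complex.exp_add, ← Complex.exp_add, hf]
      simp only
      congr 1
      rw [hb]; push_cast; ring
    rw [e1]
    simp only [Pi.sub_apply]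
    have e2 : omb γ / be γ 1 q - om γ / al γ 1 q = (omb γ ^ 2 - om γ ^ 2) * ((be γ 1 q)⁻¹ * (al γ 1 q)⁻¹) := by
      field_simp
      simp only [al, be, Complex.ofReal_one]; ring
    rw [e2]; ring
  have hmeas : Measurable f := by rw [hf]; unfold al be; fun_prop
  have hfint : IntegrableOn f (Set.Ioi 0) := by
    have hi : IntegrableOn (fun s : ℝ => (Real.cos (γ/2)) ^ (-2 : ℝ) * (s + 1) ^ (-2 : ℝ)) (Set.Ioi 0) :=
      (integrableOn_add_rpow_Ioi_of_lt (by norm_num) (by norm_num)).const_mul _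
    refine Integrable.mono' hi hmeas.aestronglyMeasurable ?_
    filter_upwards [ae_restrict_mem measurableSet_Ioi] with q hq
    have hq : 0 < q := hq
    have hA : 0 < ‖al γ 1 q‖ := by simpa using al_ne hγ (by linarith : 0 < 1 + q)
    rw [hf, Complex.norm_exp, Complex.add_re, ← Complex.ofReal_neg, Complex.re_ofReal_mul, Complex.re_ofReal_mul, 
      Complex.log_re, Complex.log_re, be_norm, 
      show -(d / 2 : ℝ) * Real.log ‖al γ 1 q‖ + (d - 4 : ℝ) / 2 * Real.log ‖al γ 1 q‖ = Real.log ‖al γ 1 q‖ * (-2 : ℝ) by ring,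
      ← Real.rpow_def_of_pos hA, ← Real.mul_rpow hk.le (by linarith)]
    apply Real.rpow_le_rpow_of_nonpos (by positivity) _ (by norm_num)
    rw [add_comm]; exact al_ge γ 1 q
  have hlim : Tendsto E atTop (𝓝 (Complex.exp (b * (Complex.log (omb γ) - Complex.log (om γ))))) := by
    have hinv : Tendsto (fun q : ℝ => ((q⁻¹ : ℝ) : ℂ)) atTop (𝓝 0) := by
      have := (Complex.continuous_ofReal.tendsto 0).comp (tendsto_inv_atTop_zero (𝕜 := ℝ))
      rw [Complex.ofReal_zero] at this
      exact this
    have ho : om γ ∈ Complex.slitPlane := Or.inl (by rw [om_re]; exact hk)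
    have hob : omb γ ∈ Complex.slitPlane := Or.inl (by rw [omb_re]; exact hk)
    have l1 : Tendsto (fun q : ℝ => ((q⁻¹ : ℝ) : ℂ) * omb γ + om γ) atTop (𝓝 (om γ)) := by
      simpa using (hinv.mul_const (omb γ)).add_const (om γ)
    have l2 : Tendsto (fun q : ℝ => ((q⁻¹ : ℝ) : ℂ) * om γ + omb γ) atTop (𝓝 (omb γ)) := by
      simpa using (hinv.mul_const (om γ)).add_const (omb γ)
    have l3 := ((((l2.clog hob).sub (l1.clog ho)).const_mul (b:ℂ))).cexp
    refine l3.congr' ?_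
    filter_upwards [eventually_gt_atTop 0] with q hq
    have hA := al_ne hγ (by linarith : 0 < 1 + q)
    have hB := be_ne hγ (by linarith : 0 < 1 + q)
    have hqc : (q : ℂ) ≠ 0 := by exact_mod_cast hq.ne'
    have e1 : ((q⁻¹ : ℝ) : ℂ) * omb γ + om γ = ((q⁻¹ : ℝ) : ℂ) * al γ 1 q := by
      simp only [al]; push_cast; field_simp
    have e2 : ((q⁻¹ : ℝ) : ℂ) * om γ + omb γ = ((q⁻¹ : ℝ) : ℂ) * be γ 1 q := by
      simp only [be]; push_cast; field_simp
    rw [e1, e2, Complex.log_ofReal_mul (by positivity) hA, Complex.log_ofReal_mul (by positivity) hB, hE]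
    simp only
    congr 2; ring
  have key := integral_Ioi_of_hasDerivAt_of_tendsto' hderiv (hfint.const_mul _) hlim
  rw [integral_const_mul, hE, log_om hγ, log_omb hγ] at key
  have a0 : al γ 1 0 = omb γ := by simp [al]
  have b0 : be γ 1 0 = om γ := by simp [be]
  simp only [a0, b0, log_om hγ, log_omb hγ, om_sq'] at key
  have hsin : 0 < Real.sin γ := Real.sin_pos_of_mem_Ioo hγ
  have hsc : (Real.sin γ : ℂ) ≠ 0 := by exact_mod_cast hsin.ne'
  have hbc : (b : ℂ) ≠ 0 := by exact_mod_cast hbp.ne'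
  have e3 := Complex.two_sin ((b * γ : ℝ) : ℂ)
  have e4 : Complex.exp (b * (-(((γ / 2 : ℝ) : ℂ) * Complex.I) - ((γ / 2 : ℝ) : ℂ) * Complex.I)) = 
     Complex.exp (-((b * γ : ℝ) : ℂ) * Complex.I) := by congr 1; push_cast; ring
  have e5 : Complex.exp (b * (((γ / 2 : ℝ) : ℂ) * Complex.I - -(((γ / 2 : ℝ) : ℂ) * Complex.I))) = 
     Complex.exp (((b * γ : ℝ) : ℂ) * Complex.I) := by congr 1; push_cast; ring
  rw [e4, e5] at key
  rw [← Complex.ofReal_sin] at e3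
  rw [Complex.ofReal_div, Complex.ofReal_mul, eq_div_iff (mul_ne_zero hbc hsc)]
  have e6 : (2 * Complex.I) ≠ 0 := by simp
  apply mul_left_cancel₀ e6
  have : 2 * Complex.I * (Real.sin (b * γ) : ℂ) = 
    -(Complex.exp (-((b * γ : ℝ) : ℂ) * Complex.I) - Complex.exp (((b * γ : ℝ) : ℂ) * Complex.I)) := by
    rw [show 2 * Complex.I * (Real.sin (b * γ) : ℂ) = Complex.I * (2 * (Real.sin (b * γ) : ℂ)) by ring, e3]
    linear_combination (Complex.exp (-((b * γ : ℝ) : ℂ) * Complex.I) - Complex.exp (((b * γ : ℝ) : ℂ) * Complex.I)) * Complex.I_sq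
  rw [this, ← key]
  ring

lemma s_wt_int : IntegrableOn (fun s : ℝ => s ^ (-(1/4) : ℝ) * (s + 1) ^ (-(5/4) : ℝ)) (Set.Ioi 0) := by
  have hm : Measurable (fun s : ℝ => s ^ (-(1/4) : ℝ) * (s + 1) ^ (-(5/4) : ℝ)) := by fun_prop
  rw [← Set.Ioc_union_Ioi_eq_Ioi (zero_le_one' ℝ), integrableOn_union]
  constructor
  · have h1 : IntegrableOn (fun s : ℝ => s ^ (-(1/4) : ℝ)) (Set.Ioc 0 1) := by
      rw [← intervalIntegrable_iff_integrableOn_Ioc_of_le zero_le_one]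
      exact intervalIntegral.intervalIntegrable_rpow' (by norm_num)
    refine Integrable.mono' h1 hm.aestronglyMeasurable ?_
    filter_upwards [ae_restrict_mem measurableSet_Ioc] with s hs
    have hs0 : 0 < s := hs.1
    rw [Real.norm_of_nonneg (by positivity)]
    apply mul_le_of_le_one_right (by positivity)
    exact Real.rpow_le_one_of_one_le_of_nonpos (by linarith) (by norm_num)
  · have h1 : IntegrableOn (fun s : ℝ => (s + 1) ^ (-(5/4) : ℝ)) (Set.Ioi 1) :=
      integrableOn_add_rpow_Ioi_of_lt (by norm_num) (by norm_num)
    refine Integrable.mono' h1 hm.aestronglyMeasurable ?_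
    filter_upwards [ae_restrict_mem measurableSet_Ioi] with s hs
    have hs1 : 1 < s := hs
    have hs0 : 0 < s := by linarith
    rw [Real.norm_of_nonneg (by positivity)]
    apply mul_le_of_le_one_left (by positivity)
    exact Real.rpow_le_one_of_one_le_of_nonpos hs1.le (by norm_num)

lemma quad_eval {d : ℕ} (hd : 5 ≤ d + 1) {γ : ℝ} (hγ : γ ∈ Set.Ioo 0 Real.pi) (w : ℝ) (hw : 0 < w) :
    ∫ p in Set.Ioi (0:ℝ) ×ˢ Set.Ioi (0:ℝ), HH d γ 0 w p.1 p.2 = 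
    ((K0 d * Real.Gamma ((d - 3 : ℝ) / 2) * (w / 4) ^ (-((d - 3 : ℝ) / 2)) *
      (Real.sin ((d - 2 : ℝ) / 2 * γ) / ((d - 2 : ℝ) / 2 * Real.sin γ)) : ℝ) : ℂ) := by
  have hqi := quad_int hd hγ le_rfl hw.le (by linarith : 0 < 0 + w)
  rw [Measure.volume_eq_prod] at hqi ⊢
  rw [setIntegral_prod _ hqi]
  have h1 : ∀ s ∈ Set.Ioi (0:ℝ), ∫ t in Set.Ioi (0:ℝ), HH d γ 0 w s t = 
      ∫ q in Set.Ioi (0:ℝ), s * HH d γ 0 w s (s * q) := by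
    intro s hs
    have hs : 0 < s := hs
    have hsc : (s : ℂ) ≠ 0 := by exact_mod_cast hs.ne'
    rw [integral_const_mul, integral_comp_mul_left_Ioi (fun t => HH d γ 0 w s t) 0 hs, mul_zero, Complex.real_smul]
    push_cast
    rw [mul_inv_cancel_left₀ hsc]
  rw [setIntegral_congr_fun measurableSet_Ioi h1]
  have hint : Integrable (Function.uncurry fun (s q : ℝ) => (s : ℂ) * HH d γ 0 w s (s * q)) 
     ((volume.restrict (Set.Ioi 0)).prod (volume.restrict (Set.Ioi 0))) := by
    obtain ⟨C, hC, h⟩ := quad_bd hd hγ le_rfl hw.le (by linarith : 0 < 0 + w)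
    have hi : IntegrableOn (fun s : ℝ => (s + 1) ^ (-(5/4) : ℝ)) (Set.Ioi 0) :=
      integrableOn_add_rpow_Ioi_of_lt (by norm_num) (by norm_num)
    have h2 := (Integrable.mul_prod s_wt_int hi).const_mul C
    refine Integrable.mono' h2 (Measurable.aestronglyMeasurable ?_) ?_
    · have := (HH_meas_p d γ 0 w).comp (f := fun p : ℝ × ℝ => (p.1, p.1 * p.2)) (by fun_prop)
      exact Measurable.mul (by fun_prop) this
    · rw [Measure.prod_restrict]
      filter_upwards [ae_restrict_mem (measurableSet_Ioi.prod measurableSet_Ioi)] with p hp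
      have hs : 0 < p.1 := hp.1
      have hq : 0 < p.2 := hp.2
      have h3 := (h p.1 (p.1 * p.2) hs (by positivity)).2
      simp only [Function.uncurry]
      rw [norm_mul, Complex.norm_real, Real.norm_of_nonneg hs.le]
      refine (mul_le_mul_of_nonneg_left h3 hs.le).trans (le_of_eq ?_)
      rw [show p.1 + p.1 * p.2 = p.1 * (p.2 + 1) by ring, Real.mul_rpow hs.le (by positivity),
        show (-(1/4) : ℝ) = 1 + -(5/4) by norm_num, Real.rpow_add hs, Real.rpow_one]
      ring
  rw [integral_integral_swap hint]
  rw [setIntegral_congr_fun measurableSet_Ioi (fun q hq => s_int hd hγ w q hw (le_of_lt hq)), integral_const_mul,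
    q_int hd hγ, ← Complex.ofReal_mul]

lemma const_eq (d : ℕ) (hd : 5 ≤ d + 1) (γ t : ℝ) (ht : t ≠ 0) (hs : 0 < Real.sin γ) :
    K0 d * Real.Gamma ((d - 3 : ℝ) / 2) * (t ^ 2 / 4) ^ (-((d - 3 : ℝ) / 2)) *
      (Real.sin ((d - 2 : ℝ) / 2 * γ) / ((d - 2 : ℝ) / 2 * Real.sin γ)) = 
        Real.Gamma (((d : ℝ) + 1) - 4) * Real.sin (((((d : ℝ) + 1) - 3)/2) * γ) /
          (2^(d + 1 - 1) * Real.Gamma ((((d : ℝ) + 1) - 1)/2) *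
            Real.pi ^ ((((d : ℝ) + 1) - 1)/2) * |t|^(d + 1 - 4) * Real.sin γ) := by
  obtain ⟨m, rfl⟩ : ∃ m, d = m + 4 := ⟨d - 4, by omega⟩
  have htp : 0 < |t| := abs_pos.2 ht
  have hpi := Real.pi_pos
  set a : ℝ := ((m : ℝ) + 1) / 2 with ha
  have hap : 0 < a := by positivity
  have e1 : (((m + 4 : ℕ) : ℝ) - 3) / 2 = a := by rw [ha]; push_cast; ring
  have e2 : (((m + 4 : ℕ) : ℝ) - 2) / 2 = a + 1 / 2 := by rw [ha]; push_cast; ring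
  have e3 : (((m + 4 : ℕ) : ℝ) + 1) - 4 = 2 * a := by rw [ha]; push_cast; ring
  have e4 : ((((m + 4 : ℕ) : ℝ) + 1) - 3) / 2 = a + 1 / 2 := by rw [ha]; push_cast; ring
  have e5 : ((((m + 4 : ℕ) : ℝ) + 1) - 1) / 2 = (a + 1 / 2) + 1 := by rw [ha]; push_cast; ring
  have e6 : (t ^ 2 / 4) ^ (-a) = 2 ^ (m + 1) * (|t| ^ (m + 1))⁻¹ := by
    rw [show t ^ 2 / 4 = (|t| / 2) ^ 2 by rw [div_pow, sq_abs]; norm_num, Real.rpow_neg (by positivity),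
      ← Real.rpow_natCast (|t| / 2) 2, ← Real.rpow_mul (by positivity), show ((2:ℕ):ℝ) * a = ((m + 1 : ℕ) : ℝ) by rw [ha]; push_cast; ring,
      Real.rpow_natCast, div_pow]
    field_simp
  have e7 : K0 (m + 4) = (2 ^ (m + 5))⁻¹ * (Real.pi ^ (a + 1/2 + 1))⁻¹ * (√Real.pi)⁻¹ := by
    have h4 : (4:ℝ) ^ ((((m + 4 : ℕ) : ℝ) + 1) / 2) = 2 ^ (m + 5) := by
      rw [show (4:ℝ) = 2 ^ (2:ℝ) by norm_num, ← Real.rpow_mul (by norm_num), ← Real.rpow_natCast]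
      congr 1; push_cast; ring
    have hp : Real.pi ^ ((((m + 4 : ℕ) : ℝ) + 1) / 2) = Real.pi ^ (a + 1/2 + 1) * √Real.pi := by
      rw [Real.sqrt_eq_rpow, ← Real.rpow_add hpi]
      congr 1; rw [ha]; push_cast; ring
    rw [K0, Real.rpow_neg (by positivity), Real.mul_rpow (by norm_num) hpi.le, h4, hp, mul_inv, mul_inv, mul_assoc]
  have e8 := Real.Gamma_mul_Gamma_add_half a
  have e9 : (2:ℝ) ^ (1 - 2 * a) = (2 ^ m)⁻¹ := by
    rw [show 1 - 2 * a = -(m : ℝ) by rw [ha]; ring, Real.rpow_neg (by norm_num), Real.rpow_natCast]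
  rw [e9] at e8
  have hsq : 0 < √Real.pi := Real.sqrt_pos.2 hpi
  have e10 : Real.Gamma (2 * a) = Real.Gamma a * Real.Gamma (a + 1/2) * 2 ^ m * (√Real.pi)⁻¹ := by
    rw [e8]; field_simp
  have hG := Real.Gamma_pos_of_pos hap
  have hG2 := Real.Gamma_pos_of_pos (show 0 < a + 1/2 by positivity)
  have hP : 0 < Real.pi ^ (a + 1/2 + 1) := by positivity
  rw [e1, e2, e3, e4, e5, e6, e7, e10, Real.Gamma_add_one (by positivity), show m + 4 + 1 - 1 = m + 4 by omega,
    show m + 4 + 1 - 4 = m + 1 by omega]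
  generalize Real.pi ^ (a + 1/2 + 1) = P at *
  generalize Real.sin ((a + 1/2) * γ) = S at *
  generalize Real.Gamma (a + 1/2) = G2 at *
  generalize Real.Gamma a = G1 at *
  have : a + 1/2 ≠ 0 := by positivity
  generalize a + 1/2 = B at *
  field_simp
  ring


/-- Value on the x_n-axis of the (4−n)-homogeneous fundamental
solution of L_γ, n = d+1 ≥ 5, γ ∈ (0,π). -/
theorem stmt15 (d : ℕ) (hd : 5 ≤ d + 1) (γ : ℝ) (hγ : γ ∈ Set.Ioo 0 Real.pi)
    (F : En (d+1) → ℝ)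
    (hFloc : LocallyIntegrable F volume)
    (hFcont : ContinuousOn F {(0 : En (d+1))}ᶜ)
    (hFhom : HomogeneousDeg (d+1) ((4 : ℝ) - (d+1)) F)
    (hFfund : ∀ ψ : En (d+1) → ℝ, ContDiff ℝ (⊤ : ℕ∞) ψ → HasCompactSupport ψ →
      ∫ y, F y * Lgamma d γ ψ y = ψ 0) :
    ∀ t : ℝ, t ≠ 0 →
      F (snocVec d 0 t) =
        Real.Gamma (((d : ℝ) + 1) - 4) * Real.sin (((((d : ℝ) + 1) - 3)/2) * γ) /
          (2^(d + 1 - 1) * Real.Gamma ((((d : ℝ) + 1) - 1)/2) *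
            Real.pi ^ ((((d : ℝ) + 1) - 1)/2) * |t|^(d + 1 - 4) * Real.sin γ) := by
  intro t ht
  have hl : (snocVec d 0 t) (Fin.last d) = t := by simp [snocVec]
  have hx0 : snocVec d 0 t ≠ 0 := by
    intro h
    rw [h] at hl
    exact ht (by simpa using hl.symm)
  have hr : rr d (snocVec d 0 t) 0 = 0 := by simp [rr, snocVec]
  have hw : ww d (snocVec d 0 t) 0 = t ^ 2 := by rw [ww, hl]; simp
  have h := F_formula d hd γ hγ F hFloc.aestronglyMeasurable (F_weight_int d hd F hFloc hFcont hFhom) hFfund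
    (snocVec d 0 t) hx0 (hFcont.continuousAt (isOpen_compl_singleton.mem_nhds hx0))
  rw [hr, hw, quad_eval hd hγ (t ^ 2) (by positivity), Complex.ofReal_inj] at h
  rw [h]
  exact const_eq d hd γ t ht (Real.sin_pos_of_mem_Ioo hγ)
end
end

section
/- Let m ≥ 2, n ≥ 2, α ∈ ℝ, and set Q_α(ξ′, ξ_n) := |ξ′|^{2m} − α|ξ′|^{2m−2}ξ_n² + ξ_n^{2m} for (ξ′, ξ_n) ∈ ℝ^{n−1} × ℝ. If α < α*_m := m(m−1)^{(1−m)/m}, then Q_α(ξ) > 0 for every ξ ∈ ℝⁿ\{0} (equivalently, there exists λ > 0 with Q_α(ξ) ≥ λ|ξ|^{2m} for all ξ). -/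
open MeasureTheory RealInnerProductSpace

noncomputable section

/-- |ξ′|², the squared norm of the first d coordinates of ξ ∈ ℝ^{d+1}. -/
def normSq' (d : ℕ) (ξ : En (d+1)) : ℝ := ∑ i : Fin d, (ξ i.castSucc)^2

/-- Q_α(ξ′, ξ_n) = |ξ′|^{2m} − α|ξ′|^{2m−2}ξ_n² + ξ_n^{2m}. -/
def Qalpha (d m : ℕ) (α : ℝ) (ξ : En (d+1)) : ℝ :=
  (normSq' d ξ)^m - α * (normSq' d ξ)^(m-1) * (ξ (Fin.last d))^2 + (ξ (Fin.last d))^(2*m)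

theorem key_ineq (m : ℕ) (hm : 2 ≤ m) (a b : ℝ) (ha : 0 ≤ a) (hb : 0 ≤ b) :
    ((m : ℝ) * ((m : ℝ) - 1) ^ (((1 : ℝ) - m)/m)) * (a^(m-1) * b) ≤ a^m + b^m := by
  have hm2 : (2 : ℝ) ≤ m := by exact_mod_cast hm
  have hm0 : (0 : ℝ) < m := by linarith
  have hk : (0 : ℝ) < (m : ℝ) - 1 := by linarith
  have hc : ((m - 1 : ℕ) : ℝ) = (m : ℝ) - 1 := by
    rw [Nat.cast_sub (by omega)]; simp
  have h := Real.geom_mean_le_arith_mean2_weighted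
    (w₁ := ((m : ℝ) - 1)/m) (w₂ := 1/m) (p₁ := a^m * (m/((m : ℝ) - 1))) (p₂ := b^m * m)
    (by positivity) (by positivity) (by positivity) (by positivity) (by field_simp; ring)
  rw [Real.mul_rpow (by positivity) (by positivity),
    Real.mul_rpow (by positivity) (by positivity)] at h
  have e1 : (a^m) ^ (((m : ℝ) - 1)/m) = a^(m-1) := by
    rw [← Real.rpow_natCast, ← Real.rpow_mul ha, ← Real.rpow_natCast, hc]
    congr 1; field_simp
  have e2 : (b^m) ^ (1/(m : ℝ)) = b := by
    rw [← Real.rpow_natCast, ← Real.rpow_mul hb]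
    rw [mul_one_div_cancel hm0.ne', Real.rpow_one]
  have e3 : ((m : ℝ)/((m : ℝ) - 1)) ^ (((m : ℝ) - 1)/m) * (m : ℝ) ^ (1/(m : ℝ))
      = (m : ℝ) * ((m : ℝ) - 1) ^ (((1 : ℝ) - m)/m) := by
    rw [Real.div_rpow hm0.le hk.le, div_mul_eq_mul_div, ← Real.rpow_add hm0]
    have h1 : ((m : ℝ) - 1)/m + 1/m = 1 := by field_simp; ring
    have h2 : ((1 : ℝ) - m)/m = -(((m : ℝ) - 1)/m) := by ring
    rw [h1, h2, Real.rpow_neg hk.le, Real.rpow_one, div_eq_mul_inv]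
  rw [e1, e2] at h
  rw [← e3]
  have e4 : ((m : ℝ) - 1)/m * (a^m * (m/((m : ℝ) - 1))) + 1/m * (b^m * m) = a^m + b^m := by
    have := hk.ne'
    field_simp
  rw [e4] at h
  refine le_trans (le_of_eq ?_) h
  ring

/-- For α < α*_m = m(m−1)^{(1−m)/m}, the symbol Q_α is positive on
ℝⁿ\{0} and uniformly elliptic (dimension n = d+1 ≥ 2, m ≥ 2). -/
theorem stmt17 (d m : ℕ) (hd : 1 ≤ d) (hm : 2 ≤ m) (α : ℝ)
    (hα : α < (m : ℝ) * ((m : ℝ) - 1) ^ (((1 : ℝ) - m)/m)) :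
    (∀ ξ : En (d+1), ξ ≠ 0 → 0 < Qalpha d m α ξ) ∧
      (∃ lam : ℝ, 0 < lam ∧ ∀ ξ : En (d+1), lam * ‖ξ‖^(2*m) ≤ Qalpha d m α ξ) := by
  have H : ∃ lam : ℝ, 0 < lam ∧ ∀ ξ : En (d+1), lam * ‖ξ‖^(2*m) ≤ Qalpha d m α ξ := by
    have hm2 : (2 : ℝ) ≤ m := by exact_mod_cast hm
    have hk : (0 : ℝ) < (m : ℝ) - 1 := by linarith
    have hs : 0 < (m : ℝ) * ((m : ℝ) - 1) ^ (((1 : ℝ) - m)/m) := by positivity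
    have key := key_ineq m hm
    generalize (m : ℝ) * ((m : ℝ) - 1) ^ (((1 : ℝ) - m)/m) = s at *
    have hc : 0 < 1 - max α 0 / s := by
      rw [sub_pos, div_lt_one hs]; exact max_lt hα hs
    refine ⟨(1 - max α 0 / s) / 2^(m-1), by positivity, fun ξ => ?_⟩
    have hn : ‖ξ‖^2 = normSq' d ξ + (ξ (Fin.last d))^2 := by
      rw [EuclideanSpace.norm_sq_eq, Fin.sum_univ_castSucc]
      simp [normSq']
    have ha : 0 ≤ normSq' d ξ := Finset.sum_nonneg fun i _ => sq_nonneg _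
    have hb : 0 ≤ (ξ (Fin.last d))^2 := sq_nonneg _
    rw [Qalpha, pow_mul, pow_mul, hn]
    generalize normSq' d ξ = a at *
    generalize (ξ (Fin.last d))^2 = b at *
    have h1 := key a b ha hb
    have h2 : (a+b)^m ≤ 2^(m-1) * (a^m+b^m) := add_pow_le ha hb m
    have h3 : α * (a^(m-1) * b) ≤ max α 0 * (a^(m-1) * b) := by
      gcongr; exact le_max_left _ _
    have h4 : max α 0 * (a^(m-1) * b) ≤ max α 0 / s * (a^m+b^m) := by
      calc max α 0 * (a^(m-1) * b) = max α 0 / s * (s * (a^(m-1) * b)) := by field_simp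
        _ ≤ _ := by
          apply mul_le_mul_of_nonneg_left h1
          exact div_nonneg (le_max_right _ _) hs.le
    have h5 : (1 - max α 0 / s) / 2^(m-1) * (a+b)^m ≤ (1 - max α 0 / s) * (a^m+b^m) := by
      rw [div_mul_eq_mul_div, div_le_iff₀ (by positivity), mul_assoc]
      apply mul_le_mul_of_nonneg_left _ hc.le
      linarith
    linarith
  refine ⟨fun ξ hξ => ?_, H⟩
  obtain ⟨lam, hl, h⟩ := H
  have : 0 < ‖ξ‖ := norm_pos_iff.mpr hξ
  exact lt_of_lt_of_le (by positivity) (h ξ)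
end
end
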